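/- There exist universal constants c₁, c₂, c₃ > 0 with the following property. Let n ≥ 1 be an integer, M a matroid on {1,…,n}, H ≥ 1, ε, δ ∈ (0,1), fix a strict total order ≻ on {1,…,n}, and let F = F₁ ⊗ … ⊗ F_n be a product probability measure on ℝⁿ whose marginals F_i are atomless and supported in [1,H]. Set t = ⌈c₁·(1/ε + ln(H)/ln(1+ε))⌉ and let m ≥ c₂·(H·n/ε)²·(n·t·ln(n·t+2)·(1+ln(H·n/ε)) + ln(1/δ)). Then with probability at least 1 − δ over an i.i.d. sample v¹,…,vᵐ from F, every t-level matroid auction Â for M (with tie-breaking order ≻) that maximizes Σ_{j=1}^m Rev_A(vʲ) over all such auctions A satisfies E_{v∼F}[Rev_Â(v)] ≥ (1 − c₃·ε)·OPT_M(F). -/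

import Mathlib

open MeasureTheory
open scoped ENNReal

attribute [local instance] Classical.propDecidable

/-- A `t`-level single-item auction for `n` bidders: nondecreasing thresholds
`thr i 0 ≤ thr i 1 ≤ … ≤ thr i (t-1)` for each bidder `i`. -/
structure TLevel (n t : ℕ) where
  thr : Fin n → Fin t → ℝ
  mono : ∀ i, Monotone (thr i)

namespace TLevel

/-- The level of a bid `b` for bidder `i`: the largest index `τ` with `thr i τ ≤ b`,
or `-1` if no threshold is met (computed as the number of met thresholds minus one,
which coincides with the largest met index since the thresholds are nondecreasing). -/
noncomputable def level {n t : ℕ} (A : TLevel n t) (i : Fin n) (b : ℝ) : ℤ :=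
  ((Finset.univ.filter fun τ : Fin t => A.thr i τ ≤ b).card : ℤ) - 1

/-- Bidder `i` wins: her level is ≥ 0 and she beats every other bidder, either by a
strictly higher level or by the tie-breaking order `succ` at equal levels. -/
def wins {n t : ℕ} (A : TLevel n t) (succ : Fin n → Fin n → Prop)
    (v : Fin n → ℝ) (i : Fin n) : Prop :=
  0 ≤ A.level i (v i) ∧ ∀ j : Fin n, j ≠ i →
    (A.level j (v j) < A.level i (v i) ∨
      (A.level j (v j) = A.level i (v i) ∧ succ i j))

/-- The winner's payment: the infimum over bids at which she would still win. -/
noncomputable def payment {n t : ℕ} (A : TLevel n t) (succ : Fin n → Fin n → Prop)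
    (v : Fin n → ℝ) (i : Fin n) : ℝ :=
  sInf {b : ℝ | A.wins succ (Function.update v i b) i}

/-- The revenue of the auction on profile `v`: the winner (if any) pays her
critical bid; losers pay nothing. -/
noncomputable def Rev {n t : ℕ} (A : TLevel n t) (succ : Fin n → Fin n → Prop)
    (v : Fin n → ℝ) : ℝ :=
  ∑ i : Fin n, if A.wins succ v i then A.payment succ v i else 0

end TLevel

/-- A matroid on a ground set `E`, given by its independent sets: nonempty (contains ∅),
downward closed, and satisfying the exchange property. -/
structure SimpleMatroid (E : Type*) [DecidableEq E] where
  Indep : Finset E → Prop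
  empty_indep : Indep ∅
  subset_indep : ∀ ⦃I J : Finset E⦄, Indep J → I ⊆ J → Indep I
  exchange : ∀ ⦃I J : Finset E⦄, Indep I → Indep J → I.card < J.card →
    ∃ e ∈ J, e ∉ I ∧ Indep (insert e I)

/-- Greedily scan a list of bidders, adding each eligible bidder whenever the
result stays independent in the matroid `M`. -/
noncomputable def greedyAux {n : ℕ} (M : SimpleMatroid (Fin n)) (ok : Fin n → Prop) :
    List (Fin n) → Finset (Fin n) → Finset (Fin n)
  | [], W => W
  | i :: rest, W =>
      greedyAux M ok rest (if ok i ∧ M.Indep (insert i W) then insert i W else W)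

/-- The winning set of the `t`-level matroid auction `(M, A, succ)` on profile `v`:
consider the bidders with level ≥ 0 in order of decreasing level, breaking ties within
a level by `succ`, and greedily add each bidder whenever independence in `M` is kept. -/
noncomputable def winSet {n t : ℕ} (M : SimpleMatroid (Fin n)) (A : TLevel n t)
    (succ : Fin n → Fin n → Prop) (v : Fin n → ℝ) : Finset (Fin n) :=
  greedyAux M (fun i => 0 ≤ A.level i (v i))
    (List.insertionSort
      (fun i j => A.level j (v j) < A.level i (v i) ∨
        (A.level i (v i) = A.level j (v j) ∧ succ i j))
      (List.finRange n)) ∅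

/-- The payment of bidder `i` in the `t`-level matroid auction: the infimum over bids
at which `i` would still be a winner (losers pay 0 in `RevM` below). -/
noncomputable def paymentM {n t : ℕ} (M : SimpleMatroid (Fin n)) (A : TLevel n t)
    (succ : Fin n → Fin n → Prop) (v : Fin n → ℝ) (i : Fin n) : ℝ :=
  sInf {b : ℝ | i ∈ winSet M A succ (Function.update v i b)}

/-- The revenue of the `t`-level matroid auction on profile `v`: the sum of the
winners' critical payments. -/
noncomputable def RevM {n t : ℕ} (M : SimpleMatroid (Fin n)) (A : TLevel n t)
    (succ : Fin n → Fin n → Prop) (v : Fin n → ℝ) : ℝ :=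
  ∑ i : Fin n, if i ∈ winSet M A succ v then paymentM M A succ v i else 0

/-- A deterministic DSIC-IR matroid auction for matroid `M` with valuations in `V`:
a measurable 0/1 allocation whose set of winners is independent in `M`, and measurable
nonnegative payments bounded by value times allocation, such that truthful bidding is
a dominant strategy. -/
structure MatroidDSICAuction (n : ℕ) (M : SimpleMatroid (Fin n)) (V : Set ℝ) where
  alloc : (Fin n → ℝ) → Fin n → ℝ
  pay : (Fin n → ℝ) → Fin n → ℝ
  alloc_meas : ∀ i, Measurable fun v => alloc v i
  pay_meas : ∀ i, Measurable fun v => pay v i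
  alloc01 : ∀ v i, alloc v i = 0 ∨ alloc v i = 1
  feas : ∀ v, M.Indep (Finset.univ.filter fun i => alloc v i = 1)
  pay_nonneg : ∀ v i, 0 ≤ pay v i
  pay_le : ∀ v, (∀ j, v j ∈ V) → ∀ i, pay v i ≤ v i * alloc v i
  dsic : ∀ v : Fin n → ℝ, (∀ j, v j ∈ V) → ∀ (i : Fin n) (b : ℝ), b ∈ V →
    v i * alloc (Function.update v i b) i - pay (Function.update v i b) i ≤
      v i * alloc v i - pay v i

/-- `OPTM n M V F`: the supremum of expected revenue over all DSIC-IR matroid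
auctions for `M` with valuations in `V`, for bid distribution `F`. -/
noncomputable def OPTM (n : ℕ) (M : SimpleMatroid (Fin n)) (V : Set ℝ)
    (F : Measure (Fin n → ℝ)) : ℝ≥0∞ :=
  ⨆ A : MatroidDSICAuction n M V, ∫⁻ v, ∑ i, ENNReal.ofReal (A.pay v i) ∂F

/-! ### The greedy winning set of a level vector -/

/-- Bidder `i` is scanned before bidder `j`. -/
def scanBefore {n : ℕ} (succ : Fin n → Fin n → Prop) (L : Fin n → ℤ) (i j : Fin n) : Prop :=
  L j < L i ∨ (L i = L j ∧ succ i j)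

/-- The winning set as a function of the vector of levels. -/
noncomputable def greedySet {n : ℕ} (M : SimpleMatroid (Fin n)) (succ : Fin n → Fin n → Prop)
    (L : Fin n → ℤ) : Finset (Fin n) :=
  greedyAux M (fun i => 0 ≤ L i)
    (List.insertionSort (fun i j => L j < L i ∨ (L i = L j ∧ succ i j)) (List.finRange n)) ∅

/-- The vector of levels of a profile. -/
noncomputable def TLevel.levels {n t : ℕ} (A : TLevel n t) (v : Fin n → ℝ) : Fin n → ℤ :=
  fun i => A.level i (v i)

lemma winSet_eq_greedySet {n t : ℕ} (M : SimpleMatroid (Fin n)) (A : TLevel n t)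
    (succ : Fin n → Fin n → Prop) (v : Fin n → ℝ) :
    winSet M A succ v = greedySet M succ (A.levels v) := rfl

lemma scanBefore_irrefl {n : ℕ} {succ : Fin n → Fin n → Prop} [IsStrictTotalOrder (Fin n) succ]
    (L : Fin n → ℤ) (i : Fin n) : ¬ scanBefore succ L i i := by
  rintro (h | h)
  · exact lt_irrefl _ h
  · exact irrefl (r := succ) i h.2

lemma scanBefore_trans {n : ℕ} {succ : Fin n → Fin n → Prop} [IsStrictTotalOrder (Fin n) succ]
    {L : Fin n → ℤ} {i j k : Fin n} (hij : scanBefore succ L i j) (hjk : scanBefore succ L j k) :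
    scanBefore succ L i k := by
  rcases hij with h | ⟨h, hs⟩ <;> rcases hjk with h' | ⟨h', hs'⟩
  · exact Or.inl (h'.trans h)
  · exact Or.inl (h' ▸ h)
  · exact Or.inl (h ▸ h')
  · exact Or.inr ⟨h.trans h', _root_.trans hs hs'⟩

lemma scanBefore_total {n : ℕ} {succ : Fin n → Fin n → Prop} [IsStrictTotalOrder (Fin n) succ]
    (L : Fin n → ℤ) {i j : Fin n} (hij : i ≠ j) :
    scanBefore succ L i j ∨ scanBefore succ L j i := by
  rcases lt_trichotomy (L i) (L j) with h | h | h
  · exact Or.inr (Or.inl h)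
  · rcases trichotomous_of succ i j with hs | hs | hs
    · exact Or.inl (Or.inr ⟨h, hs⟩)
    · exact absurd hs hij
    · exact Or.inr (Or.inr ⟨h.symm, hs⟩)
  · exact Or.inl (Or.inl h)

lemma pairwise_orderedInsert_of_total {α : Type*} {r : α → α → Prop} [DecidableRel r]
    (htrans : ∀ a b c, r a b → r b c → r a c) (a : α) :
    ∀ l : List α, l.Pairwise r → (∀ b ∈ l, r a b ∨ r b a) → (l.orderedInsert r a).Pairwise r
  | [], _, _ => by simp
  | b :: l, hl, htot => by
    rw [List.pairwise_cons] at hl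
    rw [List.orderedInsert_cons]
    split_ifs with hab
    · refine List.pairwise_cons.2 ⟨fun c hc => ?_, List.pairwise_cons.2 hl⟩
      rcases List.mem_cons.1 hc with rfl | hc
      · exact hab
      · exact htrans _ _ _ hab (hl.1 c hc)
    · have hba : r b a := (htot b (by simp)).resolve_left hab
      refine List.pairwise_cons.2 ⟨fun c hc => ?_,
        pairwise_orderedInsert_of_total htrans a l hl.2 fun c hc => htot c (by simp [hc])⟩
      rcases (List.mem_orderedInsert r).1 hc with rfl | hc
      · exact hba
      · exact hl.1 c hc

lemma pairwise_insertionSort_of_nodup {α : Type*} {r : α → α → Prop} [DecidableRel r]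
    (htrans : ∀ a b c, r a b → r b c → r a c) (htot : ∀ a b, a ≠ b → r a b ∨ r b a) :
    ∀ l : List α, l.Nodup → (l.insertionSort r).Pairwise r
  | [], _ => by simp
  | a :: l, hl => by
    rw [List.nodup_cons] at hl
    rw [List.insertionSort_cons]
    refine pairwise_orderedInsert_of_total htrans a _
      (pairwise_insertionSort_of_nodup htrans htot l hl.2) fun b hb => htot a b ?_
    rintro rfl
    exact hl.1 ((List.mem_insertionSort r).1 hb)

lemma indep_greedyAux {n : ℕ} (M : SimpleMatroid (Fin n)) (ok : Fin n → Prop) :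
    ∀ (l : List (Fin n)) (W : Finset (Fin n)), M.Indep W → M.Indep (greedyAux M ok l W)
  | [], W, hW => hW
  | i :: l, W, hW => by
    rw [greedyAux]
    refine indep_greedyAux M ok l _ ?_
    split_ifs with h
    · exact h.2
    · exact hW

lemma greedyAux_spec {n : ℕ} (M : SimpleMatroid (Fin n)) (ok : Fin n → Prop)
    {r : Fin n → Fin n → Prop} (hirr : ∀ a, ¬ r a a) (htrans : ∀ a b c, r a b → r b c → r a c) :
    ∀ (l : List (Fin n)) (W : Finset (Fin n)), l.Pairwise r → (∀ a ∈ W, ∀ b ∈ l, r a b) →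
      (∀ j, j ∉ l → (j ∈ greedyAux M ok l W ↔ j ∈ W)) ∧ W ⊆ greedyAux M ok l W ∧
      ∀ j ∈ l, (j ∈ greedyAux M ok l W ↔
        ok j ∧ M.Indep (insert j ((greedyAux M ok l W).filter (r · j))))
  | [], W, _, _ => by simp [greedyAux]
  | i :: l, W, hl, hW => by
    rw [List.pairwise_cons] at hl
    rw [greedyAux]
    set W₁ := if ok i ∧ M.Indep (insert i W) then insert i W else W with hW₁
    have hsub : W₁ ⊆ insert i W := by
      rw [hW₁]; split_ifs
      · exact subset_rfl
      · exact Finset.subset_insert _ _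
    have hsup : W ⊆ W₁ := by
      rw [hW₁]; split_ifs
      · exact Finset.subset_insert _ _
      · exact subset_rfl
    have hiW : i ∉ W := fun h => hirr i (hW i h i (by simp))
    have hil : i ∉ l := fun h => hirr i (hl.1 i h)
    have hi₁ : i ∈ W₁ ↔ ok i ∧ M.Indep (insert i W) := by
      rw [hW₁]; split_ifs with h
      · simp [h]
      · simp [h, hiW]
    obtain ⟨h1, h2, h3⟩ := greedyAux_spec M ok hirr htrans l W₁ hl.2 (by
      intro a ha b hb
      rcases Finset.mem_insert.1 (hsub ha) with rfl | ha
      · exact hl.1 b hb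
      · exact hW a ha b (by simp [hb]))
    refine ⟨fun j hj => ?_, hsup.trans h2, fun j hj => ?_⟩
    · rw [List.mem_cons, not_or] at hj
      rw [h1 j hj.2]
      refine ⟨fun h => (Finset.mem_insert.1 (hsub h)).resolve_left hj.1, fun h => hsup h⟩
    · rcases List.mem_cons.1 hj with rfl | hj
      · have : (greedyAux M ok l W₁).filter (r · j) = W := by
          ext a
          rw [Finset.mem_filter]
          constructor
          · rintro ⟨ha, hr⟩
            have hal : a ∉ l := fun h => hirr a (htrans _ _ _ hr (hl.1 a h))
            refine (Finset.mem_insert.1 (hsub ((h1 a hal).1 ha))).resolve_left ?_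
            rintro rfl
            exact hirr _ hr
          · exact fun ha => ⟨h2 (hsup ha), hW a ha j (by simp)⟩
        rw [this, h1 j hil, hi₁]
      · exact h3 j hj

section greedy

variable {n : ℕ} (M : SimpleMatroid (Fin n)) {succ : Fin n → Fin n → Prop}

lemma indep_greedySet (L : Fin n → ℤ) : M.Indep (greedySet M succ L) :=
  indep_greedyAux M _ _ _ M.empty_indep

variable (succ) in
/-- The least level at which bidder `i` wins against the levels of the others. -/
noncomputable def critLevel (L : Fin n → ℤ) (i : Fin n) : ℤ :=
  sInf {k | i ∈ greedySet M succ (Function.update L i k)}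

lemma critLevel_update (L : Fin n → ℤ) (i : Fin n) (k : ℤ) :
    critLevel M succ (Function.update L i k) i = critLevel M succ L i := by
  simp [critLevel]

variable [IsStrictTotalOrder (Fin n) succ]

lemma mem_greedySet (L : Fin n → ℤ) (j : Fin n) :
    j ∈ greedySet M succ L ↔
      0 ≤ L j ∧ M.Indep (insert j ((greedySet M succ L).filter (scanBefore succ L · j))) := by
  have h := (greedyAux_spec M (fun i => 0 ≤ L i) (scanBefore_irrefl (succ := succ) L)
    (fun _ _ _ => scanBefore_trans)
    (List.insertionSort (fun i j => L j < L i ∨ (L i = L j ∧ succ i j)) (List.finRange n)) ∅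
    (pairwise_insertionSort_of_nodup (r := fun i j => L j < L i ∨ (L i = L j ∧ succ i j))
      (fun _ _ _ => scanBefore_trans) (fun _ _ => scanBefore_total L) _ (List.nodup_finRange n))
    (by simp)).2.2 j
    ((List.mem_insertionSort _).2 (List.mem_finRange j))
  exact h

lemma mem_greedySet_update_of_scanBefore {L : Fin n → ℤ} {i : Fin n} {k k' : ℤ} (hk : k ≤ k')
    (j : Fin n) (hj : scanBefore succ (Function.update L i k') j i) :
    j ∈ greedySet M succ (Function.update L i k') ↔
      j ∈ greedySet M succ (Function.update L i k) := by
  have hwf : WellFounded (scanBefore succ (Function.update L i k')) := by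
    have : IsTrans (Fin n) (scanBefore succ (Function.update L i k')) :=
      ⟨fun _ _ _ => scanBefore_trans⟩
    have : Std.Irrefl (scanBefore succ (Function.update L i k')) := ⟨scanBefore_irrefl _⟩
    exact Finite.wellFounded_of_trans_of_irrefl _
  have hiff : ∀ a b, a ≠ i → b ≠ i → (scanBefore succ (Function.update L i k') a b ↔
      scanBefore succ (Function.update L i k) a b) := by
    intro a b ha hb
    simp [scanBefore, ha, hb]
  have himp : ∀ a, a ≠ i → scanBefore succ (Function.update L i k') a i →
      scanBefore succ (Function.update L i k) a i := by
    intro a ha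
    simp only [scanBefore, Function.update_self, Function.update_of_ne ha]
    rintro (h | ⟨h, hs⟩)
    · exact Or.inl (hk.trans_lt h)
    · rcases hk.lt_or_eq with h' | h'
      · exact Or.inl (h ▸ h')
      · exact Or.inr ⟨h.trans h'.symm, hs⟩
  induction j using hwf.induction with
  | _ j ih =>
    have hji : j ≠ i := by rintro rfl; exact scanBefore_irrefl _ _ hj
    rw [mem_greedySet, mem_greedySet M (Function.update L i k), Function.update_of_ne hji,
      Function.update_of_ne hji]
    have : (greedySet M succ (Function.update L i k')).filter
          (scanBefore succ (Function.update L i k') · j) =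
        (greedySet M succ (Function.update L i k)).filter
          (scanBefore succ (Function.update L i k) · j) := by
      ext a
      rw [Finset.mem_filter, Finset.mem_filter]
      have hai : scanBefore succ (Function.update L i k') a j → a ≠ i := by
        rintro h rfl
        exact scanBefore_irrefl _ _ (scanBefore_trans h hj)
      have hai' : scanBefore succ (Function.update L i k) a j → a ≠ i := by
        rintro h rfl
        exact scanBefore_irrefl _ _ (scanBefore_trans h (himp j hji hj))
      constructor
      · rintro ⟨ha, h⟩
        exact ⟨(ih a h (scanBefore_trans h hj)).1 ha, (hiff a j (hai h) hji).1 h⟩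
      · rintro ⟨ha, h⟩
        have h' := (hiff a j (hai' h) hji).2 h
        exact ⟨(ih a h' (scanBefore_trans h' hj)).2 ha, h'⟩
    rw [this]

lemma greedySet_update_mono {L : Fin n → ℤ} {i : Fin n} {k k' : ℤ} (hk : k ≤ k')
    (hi : i ∈ greedySet M succ (Function.update L i k)) :
    i ∈ greedySet M succ (Function.update L i k') := by
  rw [mem_greedySet, Function.update_self] at hi ⊢
  refine ⟨hi.1.trans hk, M.subset_indep hi.2 (Finset.insert_subset_insert _ ?_)⟩
  intro a ha
  rw [Finset.mem_filter] at ha ⊢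
  refine ⟨(mem_greedySet_update_of_scanBefore M hk a ha.2).1 ha.1, ?_⟩
  have hai : a ≠ i := by rintro rfl; exact scanBefore_irrefl _ _ ha.2
  have h := ha.2
  simp only [scanBefore, Function.update_self, Function.update_of_ne hai] at h ⊢
  rcases h with h | ⟨h, hs⟩
  · exact Or.inl (hk.trans_lt h)
  · rcases hk.lt_or_eq with h' | h'
    · exact Or.inl (h ▸ h')
    · exact Or.inr ⟨h.trans h'.symm, hs⟩

lemma mem_greedySet_update_iff {L : Fin n → ℤ} {i : Fin n} {k₀ : ℤ}
    (hi : i ∈ greedySet M succ (Function.update L i k₀)) (k : ℤ) :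
    i ∈ greedySet M succ (Function.update L i k) ↔ critLevel M succ L i ≤ k := by
  have hbdd : BddBelow {k | i ∈ greedySet M succ (Function.update L i k)} := by
    refine ⟨0, fun x hx => ?_⟩
    have := ((mem_greedySet M _ _).1 hx).1
    rwa [Function.update_self] at this
  refine ⟨fun h => csInf_le hbdd h, fun h => greedySet_update_mono M h ?_⟩
  exact Int.csInf_mem (s := {k | i ∈ greedySet M succ (Function.update L i k)}) ⟨k₀, hi⟩ hbdd

lemma critLevel_nonneg {L : Fin n → ℤ} {i : Fin n} (hi : i ∈ greedySet M succ L) :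
    0 ≤ critLevel M succ L i := by
  have h : i ∈ greedySet M succ (Function.update L i (L i)) := by rwa [Function.update_eq_self]
  have := ((mem_greedySet M _ _).1 ((mem_greedySet_update_iff M h _).2 le_rfl)).1
  rwa [Function.update_self] at this

lemma card_inter_level_le {L : Fin n → ℤ} {I : Finset (Fin n)} (hI : M.Indep I) {k : ℤ}
    (hk : 0 ≤ k) :
    (I.filter (k ≤ L ·)).card ≤ ((greedySet M succ L).filter (k ≤ L ·)).card := by
  by_contra! hlt
  obtain ⟨e, heI, heW, hind⟩ := M.exchange
    (M.subset_indep (indep_greedySet M (succ := succ) L) (Finset.filter_subset (k ≤ L ·) _))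
    (M.subset_indep hI (Finset.filter_subset (k ≤ L ·) _)) hlt
  have hek : k ≤ L e := (Finset.mem_filter.1 heI).2
  refine heW (Finset.mem_filter.2 ⟨(mem_greedySet M L e).2 ⟨hk.trans hek,
    M.subset_indep hind (Finset.insert_subset_insert _ fun a ha => ?_)⟩, hek⟩)
  rw [Finset.mem_filter] at ha ⊢
  refine ⟨ha.1, hek.trans ?_⟩
  rcases ha.2 with h | h
  · exact h.le
  · exact h.1.ge

/-- The greedy set has maximal weight for weights monotone in the level and vanishing at the
lowest levels. -/
lemma sum_le_sum_greedySet {L : Fin n → ℤ} {I : Finset (Fin n)} (hI : M.Indep I)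
    {Λ : ℕ → ℝ} (hΛ : Monotone Λ) (hΛ0 : Λ 0 = 0) :
    ∑ i ∈ I, Λ (L i).toNat ≤ ∑ i ∈ greedySet M succ L, Λ (L i).toNat := by
  obtain ⟨N, hN⟩ : ∃ N : ℕ, ∀ i, (L i).toNat ≤ N :=
    ⟨∑ i, (L i).toNat, fun i => Finset.single_le_sum (f := fun i => (L i).toNat)
      (fun _ _ => Nat.zero_le _) (Finset.mem_univ i)⟩
  have key : ∀ J : Finset (Fin n), ∑ i ∈ J, Λ (L i).toNat =
      ∑ s ∈ Finset.range N, (Λ (s + 1) - Λ s) *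
        ((J.filter ((s : ℤ) + 1 ≤ L ·)).card : ℝ) := by
    intro J
    have h1 : ∀ i, Λ (L i).toNat = ∑ s ∈ Finset.range N,
        if (s : ℤ) + 1 ≤ L i then Λ (s + 1) - Λ s else 0 := by
      intro i
      rw [← Finset.sum_filter]
      have : (Finset.range N).filter (fun s : ℕ => (s : ℤ) + 1 ≤ L i) =
          Finset.range (L i).toNat := by
        ext s
        have := hN i
        simp only [Finset.mem_filter, Finset.mem_range]
        omega
      rw [this, Finset.sum_range_sub, hΛ0, sub_zero]
    simp_rw [h1]
    rw [Finset.sum_comm]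
    refine Finset.sum_congr rfl fun s _ => ?_
    rw [← Finset.sum_filter, Finset.sum_const, nsmul_eq_mul, mul_comm]
  rw [key, key]
  refine Finset.sum_le_sum fun s _ => mul_le_mul_of_nonneg_left ?_
    (sub_nonneg.2 (hΛ (Nat.le_succ s)))
  exact_mod_cast card_inter_level_le M hI (by positivity)

end greedy

/-! ### Levels, critical prices and revenue -/

section revenue

variable {n t : ℕ} (M : SimpleMatroid (Fin n)) (A : TLevel n t) (succ : Fin n → Fin n → Prop)

lemma TLevel.le_level_iff {k : ℕ} (hk : k < t) (i : Fin n) (b : ℝ) :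
    (k : ℤ) ≤ A.level i b ↔ A.thr i ⟨k, hk⟩ ≤ b := by
  have : (k : ℤ) ≤ A.level i b ↔
      k + 1 ≤ (Finset.univ.filter fun τ : Fin t => A.thr i τ ≤ b).card := by
    unfold TLevel.level; omega
  rw [this]
  constructor
  · intro h
    by_contra! hb
    have hsub : (Finset.univ.filter fun τ : Fin t => A.thr i τ ≤ b) ⊆ Finset.Iio ⟨k, hk⟩ := by
      intro τ hτ
      rw [Finset.mem_filter] at hτ
      rw [Finset.mem_Iio]
      by_contra! hle
      exact absurd (hb.trans_le (A.mono i hle)) hτ.2.not_gt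
    have := Finset.card_le_card hsub
    rw [Fin.card_Iio] at this
    simp only at this
    omega
  · intro h
    have hsub : Finset.Iic (⟨k, hk⟩ : Fin t) ⊆
        Finset.univ.filter fun τ : Fin t => A.thr i τ ≤ b := by
      intro τ hτ
      rw [Finset.mem_Iic] at hτ
      exact Finset.mem_filter.2 ⟨Finset.mem_univ _, (A.mono i hτ).trans h⟩
    have := Finset.card_le_card hsub
    rwa [Fin.card_Iic] at this

lemma TLevel.level_lt (i : Fin n) (b : ℝ) : A.level i b < t := by
  have := Finset.card_filter_le (Finset.univ : Finset (Fin t)) fun τ => A.thr i τ ≤ b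
  rw [Finset.card_univ, Fintype.card_fin] at this
  unfold TLevel.level
  omega

lemma TLevel.neg_one_le_level (i : Fin n) (b : ℝ) : -1 ≤ A.level i b := by
  unfold TLevel.level
  omega

lemma TLevel.levels_update (v : Fin n → ℝ) (i : Fin n) (b : ℝ) :
    A.levels (Function.update v i b) = Function.update (A.levels v) i (A.level i b) := by
  ext j
  by_cases h : j = i
  · subst h; simp [TLevel.levels]
  · simp [TLevel.levels, h]

lemma TLevel.measurable_level (i : Fin n) : Measurable (A.level i) := by
  have : A.level i = fun b => (∑ τ : Fin t, if A.thr i τ ≤ b then (1 : ℤ) else 0) - 1 := by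
    ext b
    rw [TLevel.level, Finset.card_filter]
    push_cast
    rfl
  rw [this]
  refine Measurable.sub_const (Finset.measurable_sum _ fun τ _ => ?_) _
  exact Measurable.ite measurableSet_Ici measurable_const measurable_const

lemma TLevel.measurable_levels : Measurable (A.levels (n := n)) :=
  measurable_pi_lambda _ fun i => (A.measurable_level i).comp (measurable_pi_apply i)

/-- The threshold of bidder `i` at her critical level. -/
noncomputable def critPrice (L : Fin n → ℤ) (i : Fin n) : ℝ :=
  if h : (critLevel M succ L i).toNat < t then A.thr i ⟨(critLevel M succ L i).toNat, h⟩ else 0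

lemma critPrice_update (L : Fin n → ℤ) (i : Fin n) (k : ℤ) :
    critPrice M A succ (Function.update L i k) i = critPrice M A succ L i := by
  simp [critPrice, critLevel_update]

variable [IsStrictTotalOrder (Fin n) succ]

/-- A bidder who wins with some bid faces one of her thresholds as a posted price. -/
lemma exists_thr_of_mem_winSet (v : Fin n → ℝ) (i : Fin n) (x₀ : ℝ)
    (h₀ : i ∈ winSet M A succ (Function.update v i x₀)) :
    ∃ k : Fin t, (k : ℕ) = (critLevel M succ (A.levels v) i).toNat ∧
      (∀ x, i ∈ winSet M A succ (Function.update v i x) ↔ A.thr i k ≤ x) ∧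
      critPrice M A succ (A.levels v) i = A.thr i k := by
  simp_rw [winSet_eq_greedySet, TLevel.levels_update] at h₀ ⊢
  have hiff := mem_greedySet_update_iff M h₀
  have hle := (hiff _).1 h₀
  have h0 : 0 ≤ critLevel M succ (A.levels v) i := by
    simpa [critLevel_update] using critLevel_nonneg M h₀
  have hlt := A.level_lt i x₀
  have hk : (critLevel M succ (A.levels v) i).toNat < t := by omega
  refine ⟨⟨_, hk⟩, rfl, fun x => ?_, by simp [critPrice, hk]⟩
  rw [hiff, ← A.le_level_iff hk, Int.toNat_of_nonneg h0]

lemma paymentM_eq_critPrice {v : Fin n → ℝ} {i : Fin n} (hi : i ∈ winSet M A succ v) :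
    paymentM M A succ v i = critPrice M A succ (A.levels v) i := by
  obtain ⟨k, -, hk, hp⟩ := exists_thr_of_mem_winSet M A succ v i (v i)
    (by rwa [Function.update_eq_self])
  rw [hp, paymentM]
  simp_rw [hk]
  exact csInf_Ici

lemma critPrice_le {v : Fin n → ℝ} {i : Fin n} (hi : i ∈ winSet M A succ v) :
    critPrice M A succ (A.levels v) i ≤ v i := by
  obtain ⟨k, -, hk, hp⟩ := exists_thr_of_mem_winSet M A succ v i (v i)
    (by rwa [Function.update_eq_self])
  rw [hp, ← hk, Function.update_eq_self]
  exact hi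

lemma RevM_eq_sum (v : Fin n → ℝ) :
    RevM M A succ v = ∑ i ∈ greedySet M succ (A.levels v), critPrice M A succ (A.levels v) i := by
  rw [RevM, ← Finset.sum_filter, Finset.filter_mem_eq_inter, Finset.univ_inter,
    winSet_eq_greedySet]
  refine Finset.sum_congr rfl fun i hi => paymentM_eq_critPrice M A succ ?_
  rwa [winSet_eq_greedySet]

lemma measurable_RevM : Measurable (RevM M A succ) := by
  have : RevM M A succ = (fun L => ∑ i ∈ greedySet M succ L, critPrice M A succ L i) ∘ A.levels :=
    funext fun v => RevM_eq_sum M A succ v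
  rw [this]
  exact (Measurable.of_discrete).comp A.measurable_levels

lemma RevM_le {v : Fin n → ℝ} {H : ℝ} (hH : 0 ≤ H) (hv : ∀ i, v i ≤ H) :
    RevM M A succ v ≤ n * H := by
  rw [RevM_eq_sum]
  calc _ ≤ ∑ i ∈ greedySet M succ (A.levels v), H := Finset.sum_le_sum fun i hi =>
        (critPrice_le M A succ (by rwa [winSet_eq_greedySet])).trans (hv i)
    _ ≤ n * H := by
        rw [Finset.sum_const, nsmul_eq_mul]
        refine mul_le_mul_of_nonneg_right ?_ hH
        exact_mod_cast (Finset.card_le_univ _).trans_eq (Fintype.card_fin n)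

end revenue

/-! ### A single bidder with an atomless value distribution -/

section singleBidder

lemma continuous_measureReal_Ici (F : Measure ℝ) [IsProbabilityMeasure F]
    (hatom : ∀ x, F {x} = 0) : Continuous fun p : ℝ => F.real (Set.Ici p) := by
  have hS : (fun p : ℝ => F.real (Set.Ici p)) = fun p => 1 - ProbabilityTheory.cdf F p := by
    ext p
    have : NullSingletonClass F := ⟨hatom⟩
    rw [ProbabilityTheory.cdf_eq_real, ← probReal_compl_eq_one_sub measurableSet_Iic,
      Set.compl_Iic]
    exact measureReal_congr Ioi_ae_eq_Ici.symm
  rw [hS]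
  refine continuous_const.sub (continuous_iff_continuousAt.2 fun x => ?_)
  have h := (ProbabilityTheory.cdf F).measure_singleton x
  rw [ProbabilityTheory.measure_cdf, hatom, eq_comm, ENNReal.ofReal_eq_zero, sub_nonpos] at h
  rw [(ProbabilityTheory.monotone_cdf F).continuousAt_iff_leftLim_eq_rightLim,
    (ProbabilityTheory.cdf F).rightLim_eq]
  exact le_antisymm ((ProbabilityTheory.monotone_cdf F).leftLim_le le_rfl) h

/-- Monotone optimal posted prices for the Lagrangian revenues with multipliers `Λ j`. -/
lemma exists_lagrangian_prices (F : Measure ℝ) [IsProbabilityMeasure F]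
    (hatom : ∀ x, F {x} = 0) {H : ℝ} (hH : 1 ≤ H) {Λ : ℕ → ℝ} (hΛ : Monotone Λ) :
    ∃ thr : ℕ → ℝ, Monotone thr ∧ (∀ j, thr j ∈ Set.Icc 1 H) ∧
      ∀ j, ∀ p ∈ Set.Icc 1 H, (p - Λ j) * F.real (Set.Ici p) ≤
        (thr j - Λ j) * F.real (Set.Ici (thr j)) := by
  have hS := continuous_measureReal_Ici F hatom
  have hex : ∀ j, ∃ q, IsGreatest {q | q ∈ Set.Icc 1 H ∧ ∀ p ∈ Set.Icc 1 H,
      (p - Λ j) * F.real (Set.Ici p) ≤ (q - Λ j) * F.real (Set.Ici q)} q := by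
    intro j
    have hcont : Continuous fun p : ℝ => (p - Λ j) * F.real (Set.Ici p) :=
      (continuous_id.sub continuous_const).mul hS
    refine IsCompact.exists_isGreatest ?_ ?_
    · have : {q | q ∈ Set.Icc 1 H ∧ ∀ p ∈ Set.Icc 1 H,
          (p - Λ j) * F.real (Set.Ici p) ≤ (q - Λ j) * F.real (Set.Ici q)} =
          Set.Icc 1 H ∩ ⋂ p ∈ Set.Icc 1 H,
            {q | (p - Λ j) * F.real (Set.Ici p) ≤ (q - Λ j) * F.real (Set.Ici q)} := by
        ext q; simp
      rw [this]
      exact isCompact_Icc.inter_right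
        (isClosed_biInter fun p _ => isClosed_le continuous_const hcont)
    · obtain ⟨q, hq, hmax⟩ := isCompact_Icc.exists_isMaxOn (Set.nonempty_Icc.2 hH)
        hcont.continuousOn
      exact ⟨q, hq, fun p hp => hmax hp⟩
  choose thr hthr using hex
  refine ⟨thr, monotone_nat_of_le_succ fun j => ?_, fun j => (hthr j).1.1, fun j => (hthr j).1.2⟩
  by_contra! hlt
  have h1 := (hthr j).1.2 _ (hthr (j + 1)).1.1
  have h2 := (hthr (j + 1)).1.2 _ (hthr j).1.1
  have hSle : F.real (Set.Ici (thr j)) ≤ F.real (Set.Ici (thr (j + 1))) :=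
    measureReal_mono (Set.Ici_subset_Ici.2 hlt.le)
  have hΛj := hΛ (Nat.le_succ j)
  have hmem : thr j ≤ thr (j + 1) := by
    refine (hthr (j + 1)).2 ⟨(hthr j).1.1, fun p hp => ((hthr (j + 1)).1.2 p hp).trans ?_⟩
    simp only [Nat.succ_eq_add_one] at hΛj
    nlinarith [mul_nonneg (sub_nonneg.2 hΛj) (sub_nonneg.2 hSle)]
  exact absurd hmem hlt.not_ge

variable {F : Measure ℝ} {H : ℝ} {Λ thr : ℕ → ℝ} {t : ℕ}

lemma revenue_le_sum_of_lagrangian (hΛt : Λ t = H) (hthr : Monotone thr)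
    (hmem : ∀ j, thr j ∈ Set.Icc 1 H)
    (hopt : ∀ j, ∀ p ∈ Set.Icc 1 H, (p - Λ j) * F.real (Set.Ici p) ≤
        (thr j - Λ j) * F.real (Set.Ici (thr j))) {k : ℕ} (hk : k ≤ t) :
    ∀ p ∈ Set.Icc 1 H, p * F.real (Set.Ici p) ≤ Λ k * F.real (Set.Ici p) +
      ∑ j ∈ Finset.Ico k t, (Λ (j + 1) - Λ j) * F.real (Set.Ici (max p (thr j))) := by
  induction hk using Nat.decreasingInduction with
  | self =>
    intro p hp
    rw [hΛt, Finset.Ico_self, Finset.sum_empty, add_zero]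
    exact mul_le_mul_of_nonneg_right hp.2 measureReal_nonneg
  | of_succ k hk ih =>
    intro p hp
    rw [Finset.sum_eq_sum_Ico_succ_bot hk]
    rcases le_total (thr k) p with h | h
    · rw [max_eq_left h]
      linarith [ih p hp]
    · have h1 := ih (thr k) (hmem k)
      have h2 := hopt k p hp
      have h3 : ∑ j ∈ Finset.Ico (k + 1) t,
            (Λ (j + 1) - Λ j) * F.real (Set.Ici (max (thr k) (thr j))) =
          ∑ j ∈ Finset.Ico (k + 1) t,
            (Λ (j + 1) - Λ j) * F.real (Set.Ici (max p (thr j))) := by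
        refine Finset.sum_congr rfl fun j hj => ?_
        have hkj : thr k ≤ thr j := hthr ((Nat.le_succ k).trans (Finset.mem_Ico.1 hj).1)
        rw [max_eq_right hkj, max_eq_right (h.trans hkj)]
      rw [h3] at h1
      rw [max_eq_right h]
      linarith

lemma sum_le_revenue_of_lagrangian (hH : 1 ≤ H) (hΛH : ∀ j, Λ j ≤ H)
    (hmem : ∀ j, thr j ∈ Set.Icc 1 H)
    (hopt : ∀ j, ∀ p ∈ Set.Icc 1 H, (p - Λ j) * F.real (Set.Ici p) ≤
        (thr j - Λ j) * F.real (Set.Ici (thr j))) {T k : ℕ} (hk : k ≤ T) :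
    Λ k * F.real (Set.Ici (thr k)) +
      ∑ j ∈ Finset.Ico k T, (Λ (j + 1) - Λ j) * F.real (Set.Ici (thr (j + 1))) ≤
        thr k * F.real (Set.Ici (thr k)) := by
  induction hk using Nat.decreasingInduction with
  | self =>
    have h := hopt T H ⟨hH, le_rfl⟩
    have := mul_nonneg (sub_nonneg.2 (hΛH T)) (measureReal_nonneg (μ := F) (s := Set.Ici H))
    rw [Finset.Ico_self, Finset.sum_empty]
    linarith
  | of_succ k hk ih =>
    rw [Finset.sum_eq_sum_Ico_succ_bot hk]
    have := hopt k _ (hmem (k + 1))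
    linarith

end singleBidder

section levelWeights

lemma lintegral_Ici_ofReal_step (F : Measure ℝ) [IsProbabilityMeasure F] (p : ℝ) {c₀ : ℝ}
    (hc₀ : 0 ≤ c₀) (s : Finset ℕ) {c : ℕ → ℝ} (hc : ∀ j, 0 ≤ c j) (q : ℕ → ℝ) :
    ∫⁻ x in Set.Ici p, ENNReal.ofReal (c₀ + ∑ j ∈ s, if q j ≤ x then c j else 0) ∂F =
      ENNReal.ofReal (c₀ * F.real (Set.Ici p) +
        ∑ j ∈ s, c j * F.real (Set.Ici (max p (q j)))) := by
  have hint : ∀ j, IntegrableOn (fun x => if q j ≤ x then c j else 0) (Set.Ici p) F := by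
    intro j
    refine Integrable.of_bound (C := c j) (Measurable.ite measurableSet_Ici measurable_const
      measurable_const).aestronglyMeasurable (Filter.Eventually.of_forall fun x => ?_)
    split_ifs
    · rw [Real.norm_of_nonneg (hc j)]
    · simpa using hc j
  rw [← ofReal_integral_eq_lintegral_ofReal]
  · congr 1
    rw [integral_add (integrable_const _) (integrable_finsetSum _ fun j _ => hint j),
      integral_finsetSum _ fun j _ => hint j, setIntegral_const, smul_eq_mul, mul_comm]
    congr 1
    refine Finset.sum_congr rfl fun j _ => ?_
    have : (fun x => if q j ≤ x then c j else 0) = (Set.Ici (q j)).indicator fun _ => c j := by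
      ext x; simp [Set.indicator_apply]
    rw [this, setIntegral_indicator measurableSet_Ici, setIntegral_const, smul_eq_mul, mul_comm,
      Set.Ici_inter_Ici]
  · exact (integrable_const _).add (integrable_finsetSum _ fun j _ => hint j)
  · refine Filter.Eventually.of_forall fun x => add_nonneg hc₀ (Finset.sum_nonneg fun j _ => ?_)
    split_ifs
    · exact hc j
    · exact le_rfl

variable {n t : ℕ} {A : TLevel n t} {i : Fin n} {F : Measure ℝ} [IsProbabilityMeasure F]
  {H : ℝ} {Λ thr : ℕ → ℝ}

lemma TLevel.le_level_iff_of_thr_eq (hA : ∀ j : Fin t, A.thr i j = thr j) {j : ℕ} (hj : j < t)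
    (x : ℝ) : (j : ℤ) ≤ A.level i x ↔ thr j ≤ x := by
  rw [A.le_level_iff hj, hA]

lemma lintegral_lower_weight_le (hH : 1 ≤ H) (hΛ : Monotone Λ) (hΛ0 : Λ 0 = 0)
    (hΛH : ∀ j, Λ j ≤ H) (hthr : Monotone thr) (hmem : ∀ j, thr j ∈ Set.Icc 1 H)
    (hopt : ∀ j, ∀ p ∈ Set.Icc 1 H, (p - Λ j) * F.real (Set.Ici p) ≤
        (thr j - Λ j) * F.real (Set.Ici (thr j)))
    (hA : ∀ j : Fin t, A.thr i j = thr j) {k : ℕ} (hk : k < t) :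
    ∫⁻ x in Set.Ici (thr k), ENNReal.ofReal (Λ (A.level i x).toNat) ∂F ≤
      ENNReal.ofReal (thr k) * F (Set.Ici (thr k)) := by
  have hpt : ∀ x ∈ Set.Ici (thr k), ENNReal.ofReal (Λ (A.level i x).toNat) =
      ENNReal.ofReal (Λ k + ∑ j ∈ Finset.Ico k (t - 1),
        if thr (j + 1) ≤ x then Λ (j + 1) - Λ j else 0) := by
    intro x hx
    congr 1
    have hkx : (k : ℤ) ≤ A.level i x := (TLevel.le_level_iff_of_thr_eq hA hk x).2 hx
    have hlt := A.level_lt i x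
    rw [← Finset.sum_filter]
    have : (Finset.Ico k (t - 1)).filter (fun j => thr (j + 1) ≤ x) =
        Finset.Ico k (A.level i x).toNat := by
      ext j
      rw [Finset.mem_filter, Finset.mem_Ico, Finset.mem_Ico]
      constructor
      · rintro ⟨⟨h1, h2⟩, h3⟩
        have := (TLevel.le_level_iff_of_thr_eq hA (show j + 1 < t by omega) x).2 h3
        omega
      · rintro ⟨h1, h2⟩
        refine ⟨by omega, (TLevel.le_level_iff_of_thr_eq hA (show j + 1 < t by omega) x).1 ?_⟩
        omega
    rw [this, Finset.sum_Ico_sub Λ (by omega)]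
    ring
  rw [setLIntegral_congr_fun measurableSet_Ici hpt,
    lintegral_Ici_ofReal_step F _ (hΛ0 ▸ hΛ (Nat.zero_le k))
      (Finset.Ico k (t - 1)) (c := fun j => Λ (j + 1) - Λ j)
      (fun j => sub_nonneg.2 (hΛ (Nat.le_succ j))) (fun j => thr (j + 1)),
    ← ENNReal.ofReal_toReal (measure_ne_top F (Set.Ici (thr k))),
    ← ENNReal.ofReal_mul (zero_le_one.trans (hmem k).1)]
  refine ENNReal.ofReal_le_ofReal ?_
  refine le_trans (le_of_eq ?_) (sum_le_revenue_of_lagrangian hH hΛH hmem hopt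
    (show k ≤ t - 1 by omega))
  congr 1
  refine Finset.sum_congr rfl fun j hj => ?_
  rw [max_eq_right (hthr ((Finset.mem_Ico.1 hj).1.trans (Nat.le_succ j)))]

lemma revenue_le_lintegral_upper_weight (hΛ : Monotone Λ) (hΛ0 : Λ 0 = 0)
    (hΛt : Λ t = H) (hthr : Monotone thr) (hmem : ∀ j, thr j ∈ Set.Icc 1 H)
    (hopt : ∀ j, ∀ p ∈ Set.Icc 1 H, (p - Λ j) * F.real (Set.Ici p) ≤
        (thr j - Λ j) * F.real (Set.Ici (thr j)))
    (hA : ∀ j : Fin t, A.thr i j = thr j) {p : ℝ} (hp : p ∈ Set.Icc 1 H) :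
    ENNReal.ofReal p * F (Set.Ici p) ≤
      ∫⁻ x in Set.Ici p, ENNReal.ofReal (Λ (A.level i x + 1).toNat) ∂F := by
  have hpt : ∀ x ∈ Set.Ici p, ENNReal.ofReal (Λ (A.level i x + 1).toNat) =
      ENNReal.ofReal (0 + ∑ j ∈ Finset.Ico 0 t, if thr j ≤ x then Λ (j + 1) - Λ j else 0) := by
    intro x _
    congr 1
    have hlt := A.level_lt i x
    rw [← Finset.sum_filter]
    have : (Finset.Ico 0 t).filter (fun j => thr j ≤ x) =
        Finset.Ico 0 (A.level i x + 1).toNat := by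
      ext j
      rw [Finset.mem_filter, Finset.mem_Ico, Finset.mem_Ico]
      constructor
      · rintro ⟨⟨h1, h2⟩, h3⟩
        have := (TLevel.le_level_iff_of_thr_eq hA h2 x).2 h3
        omega
      · rintro ⟨h1, h2⟩
        refine ⟨by omega, (TLevel.le_level_iff_of_thr_eq hA (show j < t by omega) x).1 ?_⟩
        omega
    rw [this, Finset.sum_Ico_sub Λ (by omega), hΛ0]
    ring
  rw [setLIntegral_congr_fun measurableSet_Ici hpt,
    lintegral_Ici_ofReal_step F _ le_rfl
      (Finset.Ico 0 t) (c := fun j => Λ (j + 1) - Λ j)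
      (fun j => sub_nonneg.2 (hΛ (Nat.le_succ j))) thr,
    ← ENNReal.ofReal_toReal (measure_ne_top F (Set.Ici p)),
    ← ENNReal.ofReal_mul (zero_le_one.trans hp.1)]
  refine ENNReal.ofReal_le_ofReal ?_
  have := revenue_le_sum_of_lagrangian hΛt hthr hmem hopt (Nat.zero_le t) p hp
  rwa [hΛ0] at this

end levelWeights

/-! ### Approximating the optimal auction by a `t`-level auction -/

section approximation

variable {n t : ℕ} (M : SimpleMatroid (Fin n)) (A : TLevel n t) (succ : Fin n → Fin n → Prop)
  {Fi : Fin n → Measure ℝ} [∀ i, IsProbabilityMeasure (Fi i)] {H : ℝ}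

lemma TLevel.measurable_of_levels (A : TLevel n t) {β : Type*} [MeasurableSpace β]
    (g : (Fin n → ℤ) → β) :
    Measurable fun v => g (A.levels v) :=
  (Measurable.of_discrete (f := g)).comp A.measurable_levels

lemma critPrice_nonneg (h0 : ∀ i j, 0 ≤ A.thr i j) (L : Fin n → ℤ) (i : Fin n) :
    0 ≤ critPrice M A succ L i := by
  unfold critPrice
  split_ifs
  · exact h0 _ _
  · exact le_rfl

lemma lintegral_ite_mem_winSet_le [IsStrictTotalOrder (Fin n) succ] (i : Fin n) {w : ℤ → ℝ≥0∞}
    (hw : ∀ k : Fin t, ∫⁻ x in Set.Ici (A.thr i k), w (A.level i x) ∂Fi i ≤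
      ENNReal.ofReal (A.thr i k) * Fi i (Set.Ici (A.thr i k))) :
    ∫⁻ v, (if i ∈ greedySet M succ (A.levels v) then w (A.level i (v i)) else 0)
        ∂(Measure.pi Fi) ≤
      ∫⁻ v, (if i ∈ greedySet M succ (A.levels v)
        then ENNReal.ofReal (critPrice M A succ (A.levels v) i) else 0) ∂(Measure.pi Fi) := by
  refine lintegral_le_of_lmarginal_le {i}
    (A.measurable_of_levels fun L => if i ∈ greedySet M succ L then w (L i) else 0)
    (A.measurable_of_levels fun L => if i ∈ greedySet M succ L then
      ENNReal.ofReal (critPrice M A succ L i) else 0) ?_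
  rw [lmarginal_singleton, lmarginal_singleton]
  intro v
  simp only [Function.update_self]
  by_cases hex : ∃ x₀, i ∈ winSet M A succ (Function.update v i x₀)
  · obtain ⟨x₀, hx₀⟩ := hex
    obtain ⟨k, -, hk, hp⟩ := exists_thr_of_mem_winSet M A succ v i x₀ hx₀
    simp_rw [← winSet_eq_greedySet, hk, TLevel.levels_update, critPrice_update, hp]
    have h1 : ∀ g : ℝ → ℝ≥0∞, ∫⁻ x, (if A.thr i k ≤ x then g x else 0) ∂Fi i =
        ∫⁻ x in Set.Ici (A.thr i k), g x ∂Fi i := by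
      intro g
      rw [← lintegral_indicator measurableSet_Ici]
      refine lintegral_congr fun x => ?_
      simp [Set.indicator_apply]
    rw [h1, h1, setLIntegral_const]
    exact hw k
  · push Not at hex
    simp_rw [← winSet_eq_greedySet, hex]
    simp

lemma ae_mem_Icc_pi (hsupp : ∀ i, Fi i (Set.Icc 1 H) = 1) :
    ∀ᵐ v ∂(Measure.pi Fi), ∀ i, v i ∈ Set.Icc 1 H := by
  rw [ae_all_iff]
  intro i
  have : ∀ᵐ x ∂Fi i, x ∈ Set.Icc 1 H :=
    (prob_compl_eq_zero_iff measurableSet_Icc).2 (hsupp i)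
  exact (Measure.quasiMeasurePreserving_eval Fi i).ae this

variable {M} in
lemma lintegral_pay_le (B : MatroidDSICAuction n M (Set.Icc 1 H)) (hH : 1 ≤ H)
    (hatom : ∀ i, ∀ x : ℝ, Fi i {x} = 0) (hsupp : ∀ i, Fi i (Set.Icc 1 H) = 1) (i : Fin n)
    {w : ℝ → ℝ≥0∞} (hwm : Measurable w)
    (hw : ∀ p ∈ Set.Icc 1 H, ENNReal.ofReal p * Fi i (Set.Ici p) ≤
      ∫⁻ x in Set.Ici p, w x ∂Fi i) :
    ∫⁻ v, ENNReal.ofReal (B.pay v i) ∂(Measure.pi Fi) ≤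
      ∫⁻ v, (if B.alloc v i = 1 then w (v i) else 0) ∂(Measure.pi Fi) := by
  have hVm : MeasurableSet {v : Fin n → ℝ | ∀ j, v j ∈ Set.Icc 1 H} := by
    simp_rw [Set.ofPred_forall]
    exact MeasurableSet.iInter fun j => (measurable_pi_apply j) measurableSet_Icc
  have hallocm : MeasurableSet {v | B.alloc v i = 1} :=
    (B.alloc_meas i) (measurableSet_singleton 1)
  have hVi : ∀ᵐ x ∂Fi i, x ∈ Set.Icc 1 H :=
    (prob_compl_eq_zero_iff measurableSet_Icc).2 (hsupp i)
  calc ∫⁻ v, ENNReal.ofReal (B.pay v i) ∂(Measure.pi Fi)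
      = ∫⁻ v, (if ∀ j, v j ∈ Set.Icc 1 H then ENNReal.ofReal (B.pay v i) else 0)
          ∂(Measure.pi Fi) := by
        refine lintegral_congr_ae ?_
        filter_upwards [ae_mem_Icc_pi hsupp] with v hv
        rw [if_pos hv]
    _ ≤ _ := ?_
  refine lintegral_le_of_lmarginal_le {i}
    (Measurable.ite hVm (B.pay_meas i).ennreal_ofReal measurable_const)
    (Measurable.ite hallocm (hwm.comp (measurable_pi_apply i)) measurable_const) ?_
  rw [lmarginal_singleton, lmarginal_singleton]
  intro v
  simp only [Function.update_self]
  by_cases hv : ∀ j, j ≠ i → v j ∈ Set.Icc 1 H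
  swap
  · push Not at hv
    obtain ⟨j, hji, hj⟩ := hv
    have : ∀ x, ¬ ∀ k, Function.update v i x k ∈ Set.Icc 1 H := by
      intro x h
      have := h j
      rw [Function.update_of_ne hji] at this
      exact hj this
    simp_rw [if_neg (this _), lintegral_zero]
    exact zero_le
  have hV : ∀ x ∈ Set.Icc 1 H, ∀ k, Function.update v i x k ∈ Set.Icc 1 H := by
    intro x hx k
    by_cases hk : k = i
    · subst hk; rwa [Function.update_self]
    · rw [Function.update_of_ne hk]; exact hv k hk
  have hdsic : ∀ x ∈ Set.Icc 1 H, ∀ y ∈ Set.Icc 1 H,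
      x * B.alloc (Function.update v i y) i - B.pay (Function.update v i y) i ≤
      x * B.alloc (Function.update v i x) i - B.pay (Function.update v i x) i := by
    intro x hx y hy
    simpa using B.dsic _ (hV x hx) i y hy
  have hIR : ∀ x ∈ Set.Icc 1 H,
      B.pay (Function.update v i x) i ≤ x * B.alloc (Function.update v i x) i := by
    intro x hx
    simpa using B.pay_le _ (hV x hx) i
  by_cases hex : ∃ x₀ ∈ Set.Icc 1 H, B.alloc (Function.update v i x₀) i = 1
  · obtain ⟨x₀, hx₀, ha₀⟩ := hex
    set θ := B.pay (Function.update v i x₀) i with hθ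
    have hpay : ∀ x ∈ Set.Icc 1 H, B.alloc (Function.update v i x) i = 1 →
        B.pay (Function.update v i x) i = θ := by
      intro x hx ha
      have h1 := hdsic x hx x₀ hx₀
      have h2 := hdsic x₀ hx₀ x hx
      rw [ha, ha₀] at h1 h2
      linarith
    have hθH : max θ 1 ∈ Set.Icc 1 H := by
      refine ⟨le_max_right _ _, max_le ?_ hH⟩
      have := hIR x₀ hx₀
      rw [ha₀, mul_one] at this
      exact this.trans hx₀.2
    calc ∫⁻ x, (if ∀ j, Function.update v i x j ∈ Set.Icc 1 H
            then ENNReal.ofReal (B.pay (Function.update v i x) i) else 0) ∂Fi i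
        ≤ ∫⁻ x, (Set.Ici (max θ 1)).indicator (fun _ => ENNReal.ofReal (max θ 1)) x ∂Fi i := by
          refine lintegral_mono_ae ?_
          filter_upwards [hVi] with x hx
          rw [if_pos (hV x hx)]
          rcases B.alloc01 (Function.update v i x) i with ha | ha
          · have := hIR x hx
            rw [ha, mul_zero] at this
            rw [ENNReal.ofReal_eq_zero.2 this]
            exact zero_le
          · have h1 := hIR x hx
            rw [hpay x hx ha, ha, mul_one] at h1
            rw [hpay x hx ha, Set.indicator_of_mem (show x ∈ Set.Ici (max θ 1) from
              max_le h1 hx.1)]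
            exact ENNReal.ofReal_le_ofReal (le_max_left _ _)
      _ = ENNReal.ofReal (max θ 1) * Fi i (Set.Ici (max θ 1)) := by
          rw [lintegral_indicator_const measurableSet_Ici]
      _ ≤ ∫⁻ x in Set.Ici (max θ 1), w x ∂Fi i := hw _ hθH
      _ = ∫⁻ x in Set.Ioi (max θ 1), w x ∂Fi i := by
          have : NullSingletonClass (Fi i) := ⟨hatom i⟩
          exact setLIntegral_congr Ioi_ae_eq_Ici.symm
      _ ≤ _ := by
          rw [← lintegral_indicator measurableSet_Ioi]
          refine lintegral_mono_ae ?_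
          filter_upwards [hVi] with x hx
          by_cases hxθ : x ∈ Set.Ioi (max θ 1)
          · rw [Set.indicator_of_mem hxθ, if_pos]
            refine (B.alloc01 _ i).resolve_left fun ha => ?_
            have h1 := hdsic x hx x₀ hx₀
            have h2 := B.pay_nonneg (Function.update v i x) i
            rw [ha, ha₀, ← hθ] at h1
            have := (le_max_left θ 1).trans_lt (Set.mem_Ioi.1 hxθ)
            linarith
          · rw [Set.indicator_of_notMem hxθ]
            exact zero_le
  · push Not at hex
    refine lintegral_mono_ae ?_
    filter_upwards [hVi] with x hx
    rw [if_pos (hV x hx)]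
    have ha := (B.alloc01 (Function.update v i x) i).resolve_right (hex x hx)
    have := hIR x hx
    rw [ha, mul_zero] at this
    rw [ENNReal.ofReal_eq_zero.2 this]
    exact zero_le

lemma exists_tlevel_near_optimal [IsStrictTotalOrder (Fin n) succ] (hH : 1 ≤ H)
    (hatom : ∀ i, ∀ x : ℝ, Fi i {x} = 0) (hsupp : ∀ i, Fi i (Set.Icc 1 H) = 1)
    {ε : ℝ} (hε : 0 ≤ ε) {Λ : ℕ → ℝ} (hΛ : Monotone Λ) (hΛ0 : Λ 0 = 0) (hΛt : Λ t = H)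
    (hΛH : ∀ j, Λ j ≤ H) (hΛstep : ∀ j, Λ (j + 1) ≤ (1 + ε) * Λ j + ε) {r : ℕ}
    (hr : ∀ I, M.Indep I → I.card ≤ r) :
    ∃ A : TLevel n t, (∀ i j, A.thr i j ∈ Set.Icc 1 H) ∧
      OPTM n M (Set.Icc 1 H) (Measure.pi Fi) ≤
        ENNReal.ofReal (1 + ε) * ∫⁻ v, ENNReal.ofReal (RevM M A succ v) ∂(Measure.pi Fi) +
          ENNReal.ofReal (ε * r) := by
  have hΛnn : ∀ j, 0 ≤ Λ j := fun j => hΛ0 ▸ hΛ (Nat.zero_le j)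
  choose thr hmono hmem hopt using fun i => exists_lagrangian_prices (Fi i) (hatom i) hH hΛ
  let A : TLevel n t := ⟨fun i j => thr i j, fun i j k hjk => hmono i hjk⟩
  have hA : ∀ i, ∀ j : Fin t, A.thr i j = thr i j := fun _ _ => rfl
  refine ⟨A, fun i j => hmem i j, iSup_le fun B => ?_⟩
  have hpt : ∀ v, ∑ i, (if B.alloc v i = 1 then
        ENNReal.ofReal (Λ (A.level i (v i) + 1).toNat) else 0) ≤
      ENNReal.ofReal (1 + ε) * (∑ i, if i ∈ greedySet M succ (A.levels v) then
        ENNReal.ofReal (Λ (A.level i (v i)).toNat) else 0) + ENNReal.ofReal (ε * r) := by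
    intro v
    rw [← Finset.sum_filter, ← Finset.sum_filter, Finset.filter_mem_eq_inter, Finset.univ_inter,
      ← ENNReal.ofReal_sum_of_nonneg fun _ _ => hΛnn _,
      ← ENNReal.ofReal_sum_of_nonneg fun _ _ => hΛnn _,
      ← ENNReal.ofReal_mul (by positivity), ← ENNReal.ofReal_add
        (mul_nonneg (by positivity) (Finset.sum_nonneg fun _ _ => hΛnn _)) (by positivity)]
    refine ENNReal.ofReal_le_ofReal ?_
    set I := Finset.univ.filter fun i => B.alloc v i = 1 with hI
    have hIcard : (I.card : ℝ) ≤ r := by exact_mod_cast hr I (B.feas v)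
    calc ∑ i ∈ I, Λ (A.level i (v i) + 1).toNat
        ≤ ∑ i ∈ I, ((1 + ε) * Λ (A.level i (v i)).toNat + ε) := by
          refine Finset.sum_le_sum fun i _ => ?_
          have h1 := A.neg_one_le_level i (v i)
          rcases h1.eq_or_lt with h | h
          · rw [← h]
            simp [hΛ0, hε]
          · rw [show (A.level i (v i) + 1).toNat = (A.level i (v i)).toNat + 1 by omega]
            exact hΛstep _
      _ = (1 + ε) * ∑ i ∈ I, Λ (A.level i (v i)).toNat + ε * I.card := by
          rw [Finset.sum_add_distrib, ← Finset.mul_sum, Finset.sum_const, nsmul_eq_mul, mul_comm ε]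
      _ ≤ _ := by
          have := sum_le_sum_greedySet M (succ := succ) (L := A.levels v) (B.feas v) hΛ hΛ0
          exact add_le_add (mul_le_mul_of_nonneg_left this (by positivity))
            (mul_le_mul_of_nonneg_left hIcard hε)
  calc ∫⁻ v, ∑ i, ENNReal.ofReal (B.pay v i) ∂(Measure.pi Fi)
      = ∑ i, ∫⁻ v, ENNReal.ofReal (B.pay v i) ∂(Measure.pi Fi) :=
        lintegral_finsetSum _ fun i _ => (B.pay_meas i).ennreal_ofReal
    _ ≤ ∑ i, ∫⁻ v, (if B.alloc v i = 1 then
          ENNReal.ofReal (Λ (A.level i (v i) + 1).toNat) else 0) ∂(Measure.pi Fi) := by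
        refine Finset.sum_le_sum fun i _ => ?_
        refine lintegral_pay_le B hH hatom hsupp i
          (w := fun x => ENNReal.ofReal (Λ (A.level i x + 1).toNat)) ?_ fun p hp =>
          revenue_le_lintegral_upper_weight hΛ hΛ0 hΛt (hmono i) (hmem i) (hopt i) (hA i) hp
        exact (Measurable.of_discrete (f := fun l : ℤ => ENNReal.ofReal (Λ (l + 1).toNat))).comp
          (A.measurable_level i)
    _ = ∫⁻ v, ∑ i, (if B.alloc v i = 1 then
          ENNReal.ofReal (Λ (A.level i (v i) + 1).toNat) else 0) ∂(Measure.pi Fi) := by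
        refine (lintegral_finsetSum _ fun i _ => Measurable.ite
          ((B.alloc_meas i) (measurableSet_singleton 1)) ?_ measurable_const).symm
        exact A.measurable_of_levels fun L => ENNReal.ofReal (Λ (L i + 1).toNat)
    _ ≤ ∫⁻ v, (ENNReal.ofReal (1 + ε) * (∑ i, if i ∈ greedySet M succ (A.levels v) then
        ENNReal.ofReal (Λ (A.level i (v i)).toNat) else 0) + ENNReal.ofReal (ε * r))
          ∂(Measure.pi Fi) := lintegral_mono hpt
    _ = ENNReal.ofReal (1 + ε) * (∑ i, ∫⁻ v, (if i ∈ greedySet M succ (A.levels v) then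
        ENNReal.ofReal (Λ (A.level i (v i)).toNat) else 0) ∂(Measure.pi Fi)) +
          ENNReal.ofReal (ε * r) := by
        rw [lintegral_add_right _ measurable_const, lintegral_const_mul', lintegral_const,
          measure_univ, mul_one, lintegral_finsetSum]
        · exact fun i _ => A.measurable_of_levels fun L => if i ∈ greedySet M succ L then
            ENNReal.ofReal (Λ (L i).toNat) else 0
        · exact ENNReal.ofReal_ne_top
    _ ≤ ENNReal.ofReal (1 + ε) * (∑ i, ∫⁻ v, (if i ∈ greedySet M succ (A.levels v) then
        ENNReal.ofReal (critPrice M A succ (A.levels v) i) else 0) ∂(Measure.pi Fi)) +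
          ENNReal.ofReal (ε * r) := by
        refine add_le_add_left (mul_le_mul_right (Finset.sum_le_sum fun i _ => ?_) _) _
        refine lintegral_ite_mem_winSet_le M A succ i
          (w := fun l => ENNReal.ofReal (Λ l.toNat)) fun k => ?_
        exact lintegral_lower_weight_le hH hΛ hΛ0 hΛH (hmono i) (hmem i) (hopt i) (hA i) k.2
    _ = _ := by
        rw [← lintegral_finsetSum]
        · congr 2
          refine lintegral_congr fun v => ?_
          rw [RevM_eq_sum, ← Finset.sum_filter, Finset.filter_mem_eq_inter, Finset.univ_inter,
            ENNReal.ofReal_sum_of_nonneg]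
          exact fun i _ => critPrice_nonneg M A succ
            (fun i j => zero_le_one.trans (hmem i j).1) _ i
        · exact fun i _ => A.measurable_of_levels fun L => if i ∈ greedySet M succ L then
            ENNReal.ofReal (critPrice M A succ L i) else 0

end approximation

/-! ### Discretizing the thresholds -/

lemma exists_monotone_cells (F : Measure ℝ) [IsProbabilityMeasure F]
    (hatom : ∀ x, F {x} = 0) {H η l : ℝ} (hη : 0 < η) (hl : 0 < l)
    (hηl : η * (H - 1) ≤ l) (hsupp : F (Set.Icc 1 H) = 1) :
    ∃ c : ℝ → ℕ, Monotone c ∧ (∀ x, c x < ⌊2 / η⌋₊ + 3) ∧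
      (∀ x y, x < 1 → 1 ≤ y → c x ≠ c y) ∧
      (∀ x ∈ Set.Icc 1 H, ∀ y ∈ Set.Icc 1 H, c x = c y → x - y ≤ l) ∧
      ∀ k, F {x | c x = k} ≤ ENNReal.ofReal η := by
  set Φ : ℝ → ℝ := fun x => ProbabilityTheory.cdf F x / η + (x - 1) / l with hΦ
  have hΦmono : Monotone Φ := by
    intro x y hxy
    have := ProbabilityTheory.monotone_cdf F hxy
    simp only [hΦ]
    gcongr
  have hΦle : ∀ x ≤ H, Φ x ≤ 2 / η := by
    intro x hx
    have h1 : (H - 1) / l ≤ 1 / η := by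
      rw [div_le_div_iff₀ hl hη]; linarith
    have h2 : (x - 1) / l ≤ (H - 1) / l := by gcongr
    have h3 : ProbabilityTheory.cdf F x / η ≤ 1 / η := by
      gcongr; exact ProbabilityTheory.cdf_le_one F x
    have : 2 / η = 1 / η + 1 / η := by ring
    simp only [hΦ]
    linarith
  have hΦnn : ∀ x, 1 ≤ x → 0 ≤ Φ x := by
    intro x hx
    have := ProbabilityTheory.cdf_nonneg F x
    have : 0 ≤ x - 1 := by linarith
    simp only [hΦ]
    positivity
  set c : ℝ → ℕ := fun x =>
    if x < 1 then 0 else if H < x then ⌊2 / η⌋₊ + 2 else ⌊Φ x⌋₊ + 1 with hc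
  have hfl : ∀ x ≤ H, ⌊Φ x⌋₊ ≤ ⌊2 / η⌋₊ := fun x hx => Nat.floor_le_floor (hΦle x hx)
  have hcmono : Monotone c := by
    intro x y hxy
    have h1 := Nat.floor_le_floor (hΦmono hxy)
    have h2 := hfl x
    simp only [hc]
    by_cases hx1 : x < 1
    · simp [hx1]
    · have hy1 : ¬ y < 1 := fun h => hx1 (hxy.trans_lt h)
      rw [if_neg hx1, if_neg hy1]
      by_cases hxH : H < x
      · rw [if_pos hxH, if_pos (hxH.trans_le hxy)]
      · rw [if_neg hxH]
        have := h2 (not_lt.1 hxH)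
        split_ifs <;> omega
  have hcdiff : ∀ x ∈ Set.Icc 1 H, ∀ y ∈ Set.Icc 1 H, c x = c y → Φ x - Φ y ≤ 1 := by
    intro x hx y hy hxy
    simp only [hc, not_lt.2 hx.1, not_lt.2 hx.2, not_lt.2 hy.1, not_lt.2 hy.2, if_false,
      add_left_inj] at hxy
    have h1 := Nat.lt_floor_add_one (Φ x)
    have h2 := Nat.floor_le (hΦnn y hy.1)
    rw [hxy] at h1
    linarith
  refine ⟨c, hcmono, fun x => ?_, fun x y hx hy => ?_,
    fun x hx y hy hxy => ?_, fun k => ?_⟩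
  · have h2 := hfl x
    simp only [hc]
    split_ifs with h h'
    · omega
    · omega
    · have := h2 (not_lt.1 h')
      omega
  · simp only [hc, hx, not_lt.2 hy, if_true, if_false]
    split_ifs <;> omega
  · rcases le_total x y with h | h
    · linarith
    · have h1 := hcdiff x hx y hy hxy
      have h2 := ProbabilityTheory.monotone_cdf F h
      simp only [hΦ] at h1
      have h3 : ProbabilityTheory.cdf F y / η ≤ ProbabilityTheory.cdf F x / η := by gcongr
      have h4 : (x - 1) / l - (y - 1) / l = (x - y) / l := by ring
      have h5 : (x - y) / l ≤ 1 := by linarith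
      rwa [div_le_one hl] at h5
  · have hcm : MeasurableSet ({x | c x = k} ∩ Set.Icc 1 H) :=
      (hcmono.measurable (measurableSet_singleton k)).inter measurableSet_Icc
    have hnull : F (Set.Icc 1 H)ᶜ = 0 := (prob_compl_eq_zero_iff measurableSet_Icc).2 hsupp
    have heq : F {x | c x = k} = F ({x | c x = k} ∩ Set.Icc 1 H) :=
      (measure_inter_conull hnull).symm
    rw [heq]
    by_contra! hlt
    obtain ⟨C, hCsub, hC, hCη⟩ := hcm.exists_lt_isCompact hlt
    have hne : C.Nonempty := by
      by_contra h
      rw [Set.not_nonempty_iff_eq_empty.1 h, measure_empty] at hCη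
      exact absurd hCη not_lt_zero
    obtain ⟨a, ha, hamin⟩ := hC.exists_isLeast hne
    obtain ⟨b, hb, hbmax⟩ := hC.exists_isGreatest hne
    have hab : a ≤ b := hamin hb
    have hCI : F C ≤ F (Set.Ioc a b) := by
      have : NullSingletonClass F := ⟨hatom⟩
      rw [measure_congr (Ioc_ae_eq_Icc (μ := F) (a := a) (b := b))]
      exact measure_mono fun x hx => ⟨hamin hx, hbmax hx⟩
    have h1 := hcdiff b (hCsub hb).2 a (hCsub ha).2 ((hCsub hb).1.trans (hCsub ha).1.symm)
    have h2 : (a - 1) / l ≤ (b - 1) / l := by gcongr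
    have h3 : (ProbabilityTheory.cdf F b - ProbabilityTheory.cdf F a) / η ≤ 1 := by
      simp only [hΦ] at h1
      rw [sub_div]
      linarith
    rw [div_le_one hη] at h3
    have h4 := (ProbabilityTheory.cdf F).measure_Ioc a b
    rw [ProbabilityTheory.measure_cdf] at h4
    rw [h4] at hCI
    exact absurd (hCη.trans_le (hCI.trans (ENNReal.ofReal_le_ofReal h3))) (lt_irrefl _)

section discretization

variable {n t : ℕ} (M : SimpleMatroid (Fin n)) (A A' : TLevel n t)
  (succ : Fin n → Fin n → Prop)

/-- The revenue, set to zero on profiles at which some winner is charged less than `1`. -/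
noncomputable def safeRev (v : Fin n → ℝ) : ℝ :=
  if ∀ i ∈ greedySet M succ (A.levels v), 1 ≤ critPrice M A succ (A.levels v) i then
    ∑ i ∈ greedySet M succ (A.levels v), critPrice M A succ (A.levels v) i else 0

lemma measurable_safeRev : Measurable (safeRev M A succ) :=
  A.measurable_of_levels fun L => if ∀ i ∈ greedySet M succ L, 1 ≤ critPrice M A succ L i then
    ∑ i ∈ greedySet M succ L, critPrice M A succ L i else 0

lemma safeRev_nonneg (v : Fin n → ℝ) : 0 ≤ safeRev M A succ v := by
  unfold safeRev
  split_ifs with h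
  · exact Finset.sum_nonneg fun i hi => zero_le_one.trans (h i hi)
  · exact le_rfl

variable {A A'} in
lemma TLevel.levels_eq_of_forall_iff {v : Fin n → ℝ}
    (h : ∀ i τ, A.thr i τ ≤ v i ↔ A'.thr i τ ≤ v i) : A.levels v = A'.levels v := by
  ext i
  simp only [TLevel.levels, TLevel.level, h]

variable [IsStrictTotalOrder (Fin n) succ]

lemma ofReal_safeRev_le (v : Fin n → ℝ) :
    ENNReal.ofReal (safeRev M A succ v) ≤ ENNReal.ofReal (RevM M A succ v) := by
  rw [RevM_eq_sum, safeRev]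
  split_ifs
  · exact le_rfl
  · simp

lemma safeRev_eq_RevM {v : Fin n → ℝ}
    (h : ∀ i ∈ greedySet M succ (A.levels v), 1 ≤ critPrice M A succ (A.levels v) i) :
    safeRev M A succ v = RevM M A succ v := by
  rw [RevM_eq_sum, safeRev, if_pos h]

lemma safeRev_le {v : Fin n → ℝ} {H : ℝ} (hH : 0 ≤ H) (hv : ∀ i, v i ≤ H) :
    safeRev M A succ v ≤ n * H := by
  rw [safeRev]
  split_ifs
  · rw [← RevM_eq_sum]
    exact RevM_le M A succ hH hv
  · positivity

variable {A A'} in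
lemma critPrice_eq_thr {v : Fin n → ℝ} {i : Fin n} (hi : i ∈ greedySet M succ (A.levels v))
    (hlev : A.levels v = A'.levels v) :
    ∃ k : Fin t, critPrice M A succ (A.levels v) i = A.thr i k ∧
      critPrice M A' succ (A'.levels v) i = A'.thr i k ∧ A.thr i k ≤ v i ∧ A'.thr i k ≤ v i := by
  have hi' : i ∈ greedySet M succ (A'.levels v) := hlev ▸ hi
  obtain ⟨k, hk, h1, h2⟩ := exists_thr_of_mem_winSet M A succ v i (v i)
    (by rwa [Function.update_eq_self, winSet_eq_greedySet])
  obtain ⟨k', hk', h1', h2'⟩ := exists_thr_of_mem_winSet M A' succ v i (v i)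
    (by rwa [Function.update_eq_self, winSet_eq_greedySet])
  obtain rfl : k = k' := by
    ext
    rw [hk, hk', hlev]
  refine ⟨k, h2, h2', (h1 _).1 ?_, (h1' _).1 ?_⟩ <;>
    rwa [Function.update_eq_self, winSet_eq_greedySet]

/-- Raising all thresholds to at least `1`. -/
noncomputable def TLevel.clamp (A : TLevel n t) : TLevel n t :=
  ⟨fun i τ => max (A.thr i τ) 1, fun i _ _ h => max_le_max_right _ (A.mono i h)⟩

/-- An empirical revenue maximizer never charges a winner less than `1` on the sample. -/
lemma one_le_critPrice_of_isMax {m : ℕ} {S : Fin m → Fin n → ℝ} (hS : ∀ j i, 1 ≤ S j i)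
    (hmax : ∑ j, RevM M A.clamp succ (S j) ≤ ∑ j, RevM M A succ (S j)) (j : Fin m) :
    ∀ i ∈ greedySet M succ (A.levels (S j)), 1 ≤ critPrice M A succ (A.levels (S j)) i := by
  have hlev : ∀ j, A.levels (S j) = A.clamp.levels (S j) := by
    intro j
    refine TLevel.levels_eq_of_forall_iff fun i τ => ?_
    simp [TLevel.clamp, hS j i]
  have hcl : ∀ j, ∀ i ∈ greedySet M succ (A.levels (S j)),
      critPrice M A.clamp succ (A.clamp.levels (S j)) i =
        max (critPrice M A succ (A.levels (S j)) i) 1 := by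
    intro j i hi
    obtain ⟨k, h1, h2, -⟩ := critPrice_eq_thr M succ hi (hlev j)
    rw [h1, h2]
    rfl
  have hle : ∀ j, RevM M A succ (S j) ≤ RevM M A.clamp succ (S j) := by
    intro j
    rw [RevM_eq_sum, RevM_eq_sum, ← hlev]
    refine Finset.sum_le_sum fun i hi => ?_
    have := hcl j i hi
    rw [← hlev] at this
    rw [this]
    exact le_max_left _ _
  intro i hi
  by_contra! hlt
  refine absurd hmax (not_le.2 (Finset.sum_lt_sum (fun j _ => hle j) ⟨j, Finset.mem_univ _, ?_⟩))
  rw [RevM_eq_sum, RevM_eq_sum, ← hlev]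
  have h1 : ∀ a ∈ greedySet M succ (A.levels (S j)),
      critPrice M A.clamp succ (A.levels (S j)) a =
        max (critPrice M A succ (A.levels (S j)) a) 1 := by
    intro a ha
    have := hcl j a ha
    rwa [← hlev] at this
  refine Finset.sum_lt_sum (fun a ha => ?_) ⟨i, hi, ?_⟩
  · rw [h1 a ha]
    exact le_max_left _ _
  · rw [h1 i hi]
    exact hlt.trans_le (le_max_right _ _)

/-- Two auctions whose thresholds lie in the same cells have close revenue at every profile
that avoids these cells. -/
lemma safeRev_le_safeRev_add {H l : ℝ} (hl : 0 ≤ l) {c : Fin n → ℝ → ℕ}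
    (hc : ∀ i, Monotone (c i)) (hc1 : ∀ i x y, x < 1 → 1 ≤ y → c i x ≠ c i y)
    (hcl : ∀ i, ∀ x ∈ Set.Icc 1 H, ∀ y ∈ Set.Icc 1 H, c i x = c i y → x - y ≤ l)
    (hAA' : ∀ i τ, c i (A.thr i τ) = c i (A'.thr i τ)) {v : Fin n → ℝ} (hv : ∀ i, v i ≤ H)
    (hbad : ∀ i τ, c i (v i) ≠ c i (A.thr i τ)) :
    safeRev M A succ v ≤ safeRev M A' succ v + n * l := by
  have hiff : ∀ i τ, A.thr i τ ≤ v i ↔ A'.thr i τ ≤ v i := by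
    have hlt : ∀ i x, c i (v i) ≠ c i x → (x ≤ v i ↔ c i x < c i (v i)) := fun i x hx =>
      ⟨fun h => lt_of_le_of_ne (hc i h) (Ne.symm hx), fun h => ((hc i).reflect_lt h).le⟩
    intro i τ
    rw [hlt i _ (hbad i τ), hlt i _ (hAA' i τ ▸ hbad i τ), hAA']
  have hlev := TLevel.levels_eq_of_forall_iff hiff
  have hone : ∀ i τ, 1 ≤ A.thr i τ → 1 ≤ A'.thr i τ := by
    intro i τ h
    by_contra! h'
    exact hc1 i _ _ h' h (hAA' i τ).symm
  by_cases hsafe : ∀ i ∈ greedySet M succ (A.levels v), 1 ≤ critPrice M A succ (A.levels v) i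
  · have hk := fun i (hi : i ∈ greedySet M succ (A.levels v)) => critPrice_eq_thr M succ hi hlev
    have hsafe' : ∀ i ∈ greedySet M succ (A'.levels v),
        1 ≤ critPrice M A' succ (A'.levels v) i := by
      intro i hi
      rw [← hlev] at hi
      obtain ⟨k, h1, h2, -⟩ := hk i hi
      have := hsafe i hi
      rw [h2]
      exact hone i k (h1 ▸ this)
    rw [safeRev, safeRev, if_pos hsafe, if_pos hsafe', ← hlev]
    calc ∑ i ∈ greedySet M succ (A.levels v), critPrice M A succ (A.levels v) i
        ≤ ∑ i ∈ greedySet M succ (A.levels v), (critPrice M A' succ (A.levels v) i + l) := by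
          refine Finset.sum_le_sum fun i hi => ?_
          obtain ⟨k, h1, h2, h3, h4⟩ := hk i hi
          have h5 := hsafe i hi
          rw [← hlev] at h2
          rw [h1] at h5
          rw [h1, h2]
          have := hcl i _ ⟨h5, h3.trans (hv i)⟩ _ ⟨hone i k h5, h4.trans (hv i)⟩ (hAA' i k)
          linarith
      _ ≤ _ := by
          rw [Finset.sum_add_distrib, Finset.sum_const, nsmul_eq_mul]
          gcongr
          exact_mod_cast (Finset.card_le_univ _).trans_eq (Fintype.card_fin n)
  · rw [safeRev, if_neg hsafe]
    have := safeRev_nonneg M A' succ v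
    positivity

end discretization

/-! ### Concentration -/

section concentration

variable {Ω : Type*} [MeasurableSpace Ω] {μ : Measure Ω} [IsProbabilityMeasure μ]

/-- **Hoeffding's inequality**, upper tail. -/
lemma measureReal_le_sum_le_exp {f : Ω → ℝ} (hf : Measurable f) {a b : ℝ}
    (hfab : ∀ᵐ x ∂μ, f x ∈ Set.Icc a b) {s : ℝ} (hs : 0 ≤ s) (m : ℕ) :
    (Measure.pi fun _ : Fin m => μ).real {S | m * ∫ x, f x ∂μ + m * s ≤ ∑ j, f (S j)} ≤
      Real.exp (-(2 * m * s ^ 2 / (b - a) ^ 2)) := by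
  have hsub := ProbabilityTheory.hasSubgaussianMGF_of_mem_Icc hf.aemeasurable hfab
  have hind := ProbabilityTheory.iIndepFun_pi (μ := fun _ : Fin m => μ)
    (X := fun _ x => f x - ∫ x, f x ∂μ) fun _ => (hf.sub_const _).aemeasurable
  have hcoord : ∀ j ∈ (Finset.univ : Finset (Fin m)),
      ProbabilityTheory.HasSubgaussianMGF (fun S : Fin m → Ω => f (S j) - ∫ x, f x ∂μ)
        ((‖b - a‖₊ / 2) ^ 2) (Measure.pi fun _ => μ) := by
    intro j _
    have hmp := measurePreserving_eval (fun _ : Fin m => μ) j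
    refine ProbabilityTheory.HasSubgaussianMGF.of_map
      (X := fun x => f x - ∫ x, f x ∂μ) (Y := Function.eval j) hmp.measurable.aemeasurable ?_
    rwa [hmp.map_eq]
  have h := ProbabilityTheory.HasSubgaussianMGF.measure_sum_ge_le_of_iIndepFun hind hcoord
    (ε := m * s) (by positivity)
  refine (le_of_eq ?_).trans (h.trans_eq ?_)
  · congr 1
    ext S
    simp only [Set.mem_ofPred_eq, Finset.sum_sub_distrib, Finset.sum_const, Finset.card_univ,
      Fintype.card_fin, nsmul_eq_mul, le_sub_iff_add_le']
  · congr 1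
    simp only [Finset.sum_const, Finset.card_univ, Fintype.card_fin, nsmul_eq_mul,
      NNReal.coe_mul, NNReal.coe_natCast, NNReal.coe_pow, NNReal.coe_div, coe_nnnorm,
      NNReal.coe_ofNat, div_pow, Real.norm_eq_abs, sq_abs]
    rcases Nat.eq_zero_or_pos m with rfl | hm
    · simp
    have hm' : (m : ℝ) ≠ 0 := by positivity
    by_cases hab : b - a = 0
    · simp [hab]
    field_simp

/-- **Hoeffding's inequality**, lower tail. -/
lemma measureReal_sum_le_le_exp {f : Ω → ℝ} (hf : Measurable f) {a b : ℝ}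
    (hfab : ∀ᵐ x ∂μ, f x ∈ Set.Icc a b) {s : ℝ} (hs : 0 ≤ s) (m : ℕ) :
    (Measure.pi fun _ : Fin m => μ).real {S | ∑ j, f (S j) ≤ m * ∫ x, f x ∂μ - m * s} ≤
      Real.exp (-(2 * m * s ^ 2 / (b - a) ^ 2)) := by
  have h := measureReal_le_sum_le_exp (μ := μ) hf.neg (a := -b) (b := -a)
    (by filter_upwards [hfab] with x hx using ⟨neg_le_neg hx.2, neg_le_neg hx.1⟩) hs m
  refine (le_of_eq ?_).trans (h.trans_eq ?_)
  · congr 1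
    ext S
    simp only [Set.mem_ofPred_eq, Pi.neg_apply, integral_neg, Finset.sum_neg_distrib]
    constructor <;> intro h <;> linarith
  · congr 4
    ring

/-- Uniform convergence from above for a class of functions which is finite up to brackets:
functions with the same code are `a`-close off a set of measure at most `p`. -/
lemma exists_forall_sum_le {𝒜 G : Type*} [Fintype G] {h : 𝒜 → Ω → ℝ} (code : 𝒜 → G)
    {V : Set Ω} (hV : ∀ᵐ x ∂μ, x ∈ V) {bad : G → Set Ω} {a B p s : ℝ}
    (hmeas : ∀ A, Measurable (h A)) (hbad : ∀ g, MeasurableSet (bad g))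
    (ha : 0 ≤ a) (hB : 0 ≤ B) (haB : a ≤ B) (hs : 0 ≤ s)
    (h0 : ∀ A x, 0 ≤ h A x) (hle : ∀ A, ∀ x ∈ V, h A x ≤ B)
    (hclose : ∀ A A', code A = code A' → ∀ x ∈ V, x ∉ bad (code A) → h A x ≤ h A' x + a)
    (hp : ∀ g, μ.real (bad g) ≤ p) (m : ℕ) :
    ∃ E : Set (Fin m → Ω),
      (Measure.pi fun _ : Fin m => μ).real E ≤
        Fintype.card G * Real.exp (-(2 * m * s ^ 2 / (3 * B) ^ 2)) ∧
      ∀ S ∉ E, (∀ j, S j ∈ V) → ∀ A,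
        ∑ j, h A (S j) ≤ m * (∫ x, h A x ∂μ + s + 2 * (a + B * p)) := by
  rcases isEmpty_or_nonempty 𝒜 with hA | ⟨⟨A₀⟩⟩
  · exact ⟨∅, by simp only [measureReal_empty]; positivity, fun _ _ _ A => hA.elim A⟩
  have hrep : ∀ g, ∃ A, (∃ A', code A' = g) → code A = g := by
    intro g
    by_cases hg : ∃ A', code A' = g
    · exact ⟨hg.choose, fun _ => hg.choose_spec⟩
    · exact ⟨A₀, fun h => absurd h hg⟩
  choose rep hrep using hrep
  have hrep' : ∀ A, code (rep (code A)) = code A := fun A => hrep _ ⟨A, rfl⟩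
  set u : G → Ω → ℝ := fun g x => h (rep g) x + a + (bad g).indicator (fun _ => B) x with hu
  have hind : ∀ g x, (bad g).indicator (fun _ => B) x ∈ Set.Icc 0 B := fun g x => by
    by_cases hx : x ∈ bad g <;> simp [hx, hB]
  have hindm : ∀ g, Measurable ((bad g).indicator fun _ : Ω => B) := fun g =>
    measurable_const.indicator (hbad g)
  have hum : ∀ g, Measurable (u g) := fun g => ((hmeas _).add_const a).add (hindm g)
  have hub : ∀ g, ∀ᵐ x ∂μ, u g x ∈ Set.Icc 0 (3 * B) := by
    intro g
    filter_upwards [hV] with x hx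
    have h1 := h0 (rep g) x
    have h2 := hle (rep g) x hx
    have h3 := hind g x
    simp only [hu]
    exact ⟨by linarith [h3.1], by linarith [h3.2]⟩
  have hinth : ∀ A, Integrable (h A) μ := fun A =>
    Integrable.of_mem_Icc 0 B (hmeas A).aemeasurable
      (by filter_upwards [hV] with x hx using ⟨h0 A x, hle A x hx⟩)
  have hintu : ∀ g, Integrable (u g) μ := fun g =>
    Integrable.of_mem_Icc 0 (3 * B) (hum g).aemeasurable (hub g)
  have hinti : ∀ g, Integrable ((bad g).indicator fun _ : Ω => B) μ := fun g =>
    Integrable.of_mem_Icc 0 B (hindm g).aemeasurable (.of_forall (hind g))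
  have hupper : ∀ A, ∀ x ∈ V, h A x ≤ u (code A) x := by
    intro A x hx
    simp only [hu]
    by_cases hb : x ∈ bad (code A)
    · have := h0 (rep (code A)) x
      have := hle A x hx
      rw [Set.indicator_of_mem hb]
      linarith
    · rw [Set.indicator_of_notMem hb, add_zero]
      exact hclose _ _ (hrep' A).symm x hx hb
  have hlower : ∀ A, ∫ x, u (code A) x ∂μ ≤ ∫ x, h A x ∂μ + 2 * (a + B * p) := by
    intro A
    have h1 : ∀ᵐ x ∂μ, u (code A) x ≤
        h A x + (2 * a + 2 * (bad (code A)).indicator (fun _ => B) x) := by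
      filter_upwards [hV] with x hx
      simp only [hu]
      by_cases hb : x ∈ bad (code A)
      · have := h0 A x
        have := hle (rep (code A)) x hx
        rw [Set.indicator_of_mem hb]
        linarith
      · have := hclose _ A (hrep' A) x hx (by rwa [hrep' A])
        rw [Set.indicator_of_notMem hb]
        linarith
    have hi2 : Integrable (fun x => 2 * (bad (code A)).indicator (fun _ => B) x) μ :=
      (hinti _).const_mul 2
    have hi3 : Integrable (fun x => 2 * a + 2 * (bad (code A)).indicator (fun _ => B) x) μ :=
      (integrable_const _).add hi2
    refine (integral_mono_ae (hintu _) ((hinth A).add hi3) h1).trans ?_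
    have h2 : ∫ x, (bad (code A)).indicator (fun _ => B) x ∂μ ≤ B * p := by
      rw [integral_indicator_const _ (hbad _), smul_eq_mul, mul_comm]
      gcongr
      exact hp _
    simp only [Pi.add_apply]
    rw [integral_add (hinth A) hi3, integral_add (integrable_const _) hi2]
    simp only [integral_const, probReal_univ, one_smul, integral_const_mul]
    linarith
  refine ⟨⋃ g, {S | m * ∫ x, u g x ∂μ + m * s ≤ ∑ j, u g (S j)}, ?_, ?_⟩
  · refine (measureReal_iUnion_fintype_le _).trans ?_
    refine (Finset.sum_le_sum fun g _ => measureReal_le_sum_le_exp (hum g) (hub g) hs m).trans ?_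
    simp
  · intro S hS hSV A
    simp only [Set.mem_iUnion, Set.mem_ofPred_eq, not_exists, not_le] at hS
    have h1 : ∑ j, h A (S j) ≤ ∑ j, u (code A) (S j) :=
      Finset.sum_le_sum fun j _ => hupper A _ (hSV j)
    have h2 := (hS (code A)).le
    have h3 : (m : ℝ) * ∫ x, u (code A) x ∂μ ≤ m * (∫ x, h A x ∂μ + 2 * (a + B * p)) := by
      gcongr
      exact hlower A
    linarith

end concentration

/-! ### Uniform deviation bound and existence of a good auction -/

section sample

variable {n t : ℕ} (M : SimpleMatroid (Fin n)) (succ : Fin n → Fin n → Prop)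
  {Fi : Fin n → Measure ℝ} [∀ i, IsProbabilityMeasure (Fi i)] {H : ℝ}

/-- With high probability no `t`-level auction looks much better on the sample than it is. -/
lemma exists_forall_sum_safeRev_le [IsStrictTotalOrder (Fin n) succ] (hn : 1 ≤ n) (ht : 1 ≤ t)
    (hH : 1 ≤ H) (hatom : ∀ i x, Fi i {x} = 0) (hsupp : ∀ i, Fi i (Set.Icc 1 H) = 1)
    {ε : ℝ} (hε : 0 < ε) (hε1 : ε ≤ 1) (m : ℕ) :
    ∃ E : Set (Fin m → Fin n → ℝ),
      (Measure.pi fun _ : Fin m => Measure.pi Fi).real E ≤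
        (⌊2 / (ε / (n ^ 2 * t * H))⌋₊ + 3 : ℝ) ^ (n * t) *
          Real.exp (-(2 * m * ε ^ 2 / (3 * (n * H)) ^ 2)) ∧
      ∀ S ∉ E, (∀ j i, S j i ∈ Set.Icc 1 H) → ∀ A : TLevel n t,
        ∑ j, safeRev M A succ (S j) ≤
          m * (∫ v, safeRev M A succ v ∂(Measure.pi Fi) + 5 * ε) := by
  have hn' : (1 : ℝ) ≤ n := by exact_mod_cast hn
  have ht' : (1 : ℝ) ≤ t := by exact_mod_cast ht
  have hH0 : 0 < H := by linarith
  have hn0 : (0 : ℝ) < n := by linarith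
  have ht0 : (0 : ℝ) < t := by linarith
  set η : ℝ := ε / (n ^ 2 * t * H) with hη
  have hη0 : 0 < η := by positivity
  have hηl : η * (H - 1) ≤ ε / n := by
    rw [hη, div_mul_eq_mul_div, div_le_div_iff₀ (by positivity) hn0]
    have h1 : (1 : ℝ) ≤ n * t := one_le_mul_of_one_le_of_one_le hn' ht'
    have h2 : H - 1 ≤ n * t * H := by nlinarith
    have h3 : 0 ≤ ε * n := by positivity
    nlinarith [mul_le_mul_of_nonneg_left h2 h3]
  choose c hc hcK hc1 hcl hcη using fun i =>
    exists_monotone_cells (Fi i) (hatom i) hη0 (div_pos hε hn0) hηl (hsupp i)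
  set K := ⌊2 / η⌋₊ + 3 with hK
  let code : TLevel n t → Fin n → Fin t → Fin K := fun A i τ => ⟨c i (A.thr i τ), hcK i _⟩
  let bad : (Fin n → Fin t → Fin K) → Set (Fin n → ℝ) := fun g =>
    ⋃ i, ⋃ τ, (fun v : Fin n → ℝ => c i (v i)) ⁻¹' {(g i τ : ℕ)}
  have hbadm : ∀ g, MeasurableSet (bad g) := fun g =>
    .iUnion fun i => .iUnion fun τ =>
      ((hc i).measurable.comp (measurable_pi_apply i)) (measurableSet_singleton _)
  have hcode : ∀ {A A' : TLevel n t}, code A = code A' →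
      ∀ i τ, c i (A.thr i τ) = c i (A'.thr i τ) := fun h i τ =>
    congrArg Fin.val (congrFun (congrFun h i) τ)
  have hp : ∀ g, (Measure.pi Fi).real (bad g) ≤ n * t * η := by
    intro g
    have hcell : ∀ i (τ : Fin t), (Measure.pi Fi).real
        ((fun v : Fin n → ℝ => c i (v i)) ⁻¹' {(g i τ : ℕ)}) ≤ η := by
      intro i τ
      have hmp := measurePreserving_eval Fi i
      have h1 := hmp.measure_preimage (s := {x | c i x = g i τ})
        ((hc i).measurable (measurableSet_singleton _)).nullMeasurableSet
      have h2 : (Measure.pi Fi) ((fun v : Fin n → ℝ => c i (v i)) ⁻¹' {(g i τ : ℕ)}) ≤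
          ENNReal.ofReal η := h1.trans_le (hcη i _)
      exact ENNReal.toReal_le_of_le_ofReal hη0.le h2
    refine (measureReal_iUnion_fintype_le _).trans ?_
    refine (Finset.sum_le_sum fun i _ => (measureReal_iUnion_fintype_le _).trans
      (Finset.sum_le_sum fun τ _ => hcell i τ)).trans ?_
    simp [mul_assoc]
  have hnl : n * (ε / n) = ε := mul_div_cancel₀ _ hn0.ne'
  obtain ⟨E, hE, hES⟩ := exists_forall_sum_le (μ := Measure.pi Fi)
    (h := fun A : TLevel n t => safeRev M A succ) code
    (V := {v | ∀ i, v i ∈ Set.Icc 1 H}) (bad := bad) (a := ε) (B := n * H) (p := n * t * η)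
    (s := ε) (ae_mem_Icc_pi hsupp) (fun A => measurable_safeRev M A succ) hbadm hε.le
    (by positivity) (by nlinarith) hε.le (fun A => safeRev_nonneg M A succ)
    (fun A v hv => safeRev_le M A succ hH0.le fun i => (hv i).2)
    (fun A A' hAA' v hv hvb => by
      have := safeRev_le_safeRev_add M A A' succ (div_pos hε hn0).le hc hc1 hcl (hcode hAA')
        (fun i => (hv i).2) fun i τ h => hvb
          (Set.mem_iUnion.2 ⟨i, Set.mem_iUnion.2 ⟨τ, h⟩⟩)
      rwa [hnl] at this)
    hp m
  refine ⟨E, hE.trans_eq ?_, fun S hS hSV A => (hES S hS hSV A).trans_eq ?_⟩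
  · congr 1
    simp only [Fintype.card_fun, Fintype.card_fin, Nat.cast_pow, ← pow_mul, hK]
    rw [mul_comm t n]
    push_cast
    rfl
  · have : n * H * (n * t * η) = ε := by
      rw [hη]
      field_simp
    rw [this]
    ring

/-- A matroid has an independent set of maximal size. -/
lemma SimpleMatroid.exists_max_indep : ∃ B, M.Indep B ∧ ∀ I, M.Indep I → I.card ≤ B.card := by
  obtain ⟨B, hB, hmax⟩ := Finset.exists_max_image (Finset.univ.filter M.Indep) Finset.card
    ⟨∅, by simp [M.empty_indep]⟩
  exact ⟨B, by simpa using hB, fun I hI => hmax I (by simpa using hI)⟩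

/-- Serving a fixed independent set at price `1`. -/
noncomputable def fixedPriceAuction (H : ℝ) {B : Finset (Fin n)} (hB : M.Indep B) :
    MatroidDSICAuction n M (Set.Icc 1 H) where
  alloc _ i := if i ∈ B then 1 else 0
  pay _ i := if i ∈ B then 1 else 0
  alloc_meas _ := measurable_const
  pay_meas _ := measurable_const
  alloc01 _ i := by by_cases h : i ∈ B <;> simp [h]
  feas _ := by simpa using hB
  pay_nonneg _ i := by positivity
  pay_le v hv i := by by_cases h : i ∈ B <;> simp [h, (hv i).1]
  dsic _ _ _ _ _ := le_rfl

lemma card_le_OPTM {B : Finset (Fin n)} (hB : M.Indep B) :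
    (B.card : ℝ≥0∞) ≤ OPTM n M (Set.Icc 1 H) (Measure.pi Fi) := by
  refine le_iSup_of_le (fixedPriceAuction M H hB) ?_
  simp [fixedPriceAuction, apply_ite ENNReal.ofReal]

/-- With `t ≥ 2 (1/ε + log H / log (1 + ε))` levels the multiplicative grid reaches `H`. -/
lemma le_one_add_pow_sub_one (hH : 1 ≤ H) {ε : ℝ} (hε : 0 < ε) (hε1 : ε ≤ 1)
    (ht : 2 * (1 / ε + Real.log H / Real.log (1 + ε)) ≤ t) : H ≤ (1 + ε) ^ t - 1 := by
  have hlog : 0 < Real.log (1 + ε) := Real.log_pos (by linarith)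
  have hε2 : ε / 2 ≤ Real.log (1 + ε) := by
    have h1 := Real.one_sub_inv_le_log_of_pos (show 0 < 1 + ε by linarith)
    have h2 : 1 - (1 + ε)⁻¹ = ε / (1 + ε) := by field_simp; ring
    have h3 : ε / 2 ≤ ε / (1 + ε) := by gcongr; linarith
    linarith
  have hlogH : 0 ≤ Real.log H := Real.log_nonneg hH
  have h1 : Real.log 2 + Real.log H ≤ t * Real.log (1 + ε) := by
    refine le_trans ?_ (mul_le_mul_of_nonneg_right ht hlog.le)
    have h2 : Real.log H / Real.log (1 + ε) * Real.log (1 + ε) = Real.log H :=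
      div_mul_cancel₀ _ hlog.ne'
    have h3 : 1 / 2 ≤ 1 / ε * Real.log (1 + ε) := by
      rw [div_mul_eq_mul_div, one_mul, div_le_div_iff₀ two_pos hε]
      linarith
    have := Real.log_two_lt_d9
    nlinarith
  have h2 : Real.log (2 * H) ≤ Real.log ((1 + ε) ^ t) := by
    rwa [Real.log_pow, Real.log_mul two_ne_zero (by linarith)]
  have h3 := (Real.log_le_log_iff (by linarith) (by positivity)).1 h2
  linarith

lemma exists_tlevel_near_optimal_of_le [IsStrictTotalOrder (Fin n) succ] (hH : 1 ≤ H)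
    (hatom : ∀ i x, Fi i {x} = 0) (hsupp : ∀ i, Fi i (Set.Icc 1 H) = 1) {ε : ℝ} (hε : 0 < ε)
    (hε1 : ε ≤ 1) (ht : 2 * (1 / ε + Real.log H / Real.log (1 + ε)) ≤ t) {r : ℕ}
    (hr : ∀ I, M.Indep I → I.card ≤ r) :
    ∃ A : TLevel n t, (∀ i j, A.thr i j ∈ Set.Icc 1 H) ∧
      OPTM n M (Set.Icc 1 H) (Measure.pi Fi) ≤
        ENNReal.ofReal (1 + ε) * ∫⁻ v, ENNReal.ofReal (RevM M A succ v) ∂(Measure.pi Fi) +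
          ENNReal.ofReal (ε * r) := by
  refine exists_tlevel_near_optimal M succ hH hatom hsupp hε.le
    (Λ := fun j => min H ((1 + ε) ^ j - 1)) ?_ ?_ ?_ (fun j => min_le_left _ _) ?_ hr
  · intro i j hij
    have : (1 + ε) ^ i ≤ (1 + ε) ^ j := pow_le_pow_right₀ (by linarith) hij
    exact min_le_min_left _ (by linarith)
  · simp only [pow_zero, sub_self]
    exact min_eq_right (by linarith)
  · exact min_eq_left (le_one_add_pow_sub_one hH hε hε1 ht)
  · intro j
    rcases le_total H ((1 + ε) ^ j - 1) with h | h
    · simp only [min_eq_left h]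
      exact (min_le_left _ _).trans (by nlinarith)
    · simp only [min_eq_right h]
      refine (min_le_right _ _).trans_eq ?_
      ring

/-- The failure probability of the empirical revenue maximizer. -/
lemma pow_mul_exp_add_exp_le (hn : 1 ≤ n) (ht : 1 ≤ t) (hH : 1 ≤ H) {ε δ : ℝ} (hε : 0 < ε)
    (hε1 : ε ≤ 1) (hδ : 0 < δ) (hδ1 : δ ≤ 1) {m : ℕ}
    (hm : 27 * (H * n / ε) ^ 2 * (n * t * Real.log (n * t + 2) * (1 + Real.log (H * n / ε)) +
      Real.log (1 / δ)) ≤ m) :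
    (⌊2 / (ε / (n ^ 2 * t * H))⌋₊ + 3 : ℝ) ^ (n * t) *
        Real.exp (-(2 * m * ε ^ 2 / (3 * (n * H)) ^ 2)) +
      Real.exp (-(2 * m * ε ^ 2 / (n * H) ^ 2)) ≤ δ := by
  have hn' : (1 : ℝ) ≤ n := by exact_mod_cast hn
  have ht' : (1 : ℝ) ≤ t := by exact_mod_cast ht
  have hH0 : 0 < H := by linarith
  have hn0 : (0 : ℝ) < n := by linarith
  have ht0 : (0 : ℝ) < t := by linarith
  have hnt : (1 : ℝ) ≤ n * t := one_le_mul_of_one_le_of_one_le hn' ht'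
  set y := H * n / ε with hy
  have hy1 : 1 ≤ y := by
    rw [hy, one_le_div hε]
    nlinarith
  have hly : 0 ≤ Real.log y := Real.log_nonneg hy1
  have hlw : 1 ≤ Real.log (n * t + 2) := by
    rw [Real.le_log_iff_exp_le (by positivity)]
    have := Real.exp_one_lt_d9
    linarith
  set w := Real.log (n * t + 2) with hw
  set X := n * t * w * (1 + Real.log y) with hX
  set D := Real.log (1 / δ) with hD
  have hD0 : 0 ≤ D := Real.log_nonneg (by rw [one_le_div hδ]; exact hδ1)
  have hX1 : 1 ≤ X :=
    one_le_mul_of_one_le_of_one_le (one_le_mul_of_one_le_of_one_le hnt hlw) (by linarith)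
  have hδD : Real.exp (-D) = δ := by
    rw [hD, one_div, Real.log_inv, neg_neg, Real.exp_log hδ]
  have hexp1 : 6 * (X + D) ≤ 2 * m * ε ^ 2 / (3 * (n * H)) ^ 2 := by
    have h1 : 2 * m * ε ^ 2 / (3 * (n * H)) ^ 2 = 2 / 9 * (m / y ^ 2) := by
      rw [hy]
      field_simp
      norm_num
    have h2 : 27 * (X + D) ≤ m / y ^ 2 := by
      rw [le_div_iff₀ (by positivity)]
      linarith
    rw [h1]
    linarith
  have hexp2 : 6 * (X + D) ≤ 2 * m * ε ^ 2 / (n * H) ^ 2 := by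
    refine hexp1.trans ?_
    have : 0 < n * H := by positivity
    exact div_le_div_of_nonneg_left (by positivity) (by positivity)
      (pow_le_pow_left₀ this.le (by linarith) 2)
  have hK : (⌊2 / (ε / (n ^ 2 * t * H))⌋₊ + 3 : ℝ) ≤ Real.exp (3 * (w * (1 + Real.log y))) := by
    have h1 : (⌊2 / (ε / (n ^ 2 * t * H))⌋₊ : ℝ) ≤ 2 * (n * t * y) := by
      refine (Nat.floor_le (by positivity)).trans_eq ?_
      rw [hy]
      field_simp
    have h2 : 1 ≤ n * t * y := one_le_mul_of_one_le_of_one_le hnt hy1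
    have h3 : (⌊2 / (ε / (n ^ 2 * t * H))⌋₊ + 3 : ℝ) ≤
        Real.exp 2 * (n * t + 2) * y := by
      have h4 : (5 : ℝ) ≤ Real.exp 2 := by
        have := Real.exp_one_gt_d9
        rw [show (2 : ℝ) = 1 + 1 by norm_num, Real.exp_add]
        nlinarith
      have h5 : n * t * y ≤ (n * t + 2) * y := by gcongr; linarith
      have h6 : 5 * ((n * t + 2) * y) ≤ Real.exp 2 * ((n * t + 2) * y) := by gcongr
      linarith
    refine h3.trans ?_
    calc Real.exp 2 * (n * t + 2) * y
        = Real.exp (2 + w + Real.log y) := by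
          rw [Real.exp_add, Real.exp_add, hw, Real.exp_log (by positivity),
            Real.exp_log (by positivity)]
      _ ≤ _ := by
          apply Real.exp_le_exp.2
          nlinarith
  have hpow : (⌊2 / (ε / (n ^ 2 * t * H))⌋₊ + 3 : ℝ) ^ (n * t) ≤ Real.exp (3 * X) := by
    refine (pow_le_pow_left₀ (by positivity) hK _).trans_eq ?_
    rw [← Real.exp_nat_mul]
    congr 1
    push_cast
    rw [hX]
    ring
  calc _ ≤ Real.exp (3 * X) * Real.exp (-(6 * (X + D))) + Real.exp (-(6 * (X + D))) := by
        gcongr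
    _ ≤ Real.exp (-D - 1) + Real.exp (-D - 1) := by
        rw [← Real.exp_add]
        gcongr <;> linarith
    _ = δ * (2 * Real.exp (-1)) := by
        rw [sub_eq_add_neg, Real.exp_add, hδD]
        ring
    _ ≤ δ := by
        refine mul_le_of_le_one_right hδ.le ?_
        rw [Real.exp_neg, ← div_eq_mul_inv, div_le_one (Real.exp_pos _)]
        have := Real.exp_one_gt_d9
        linarith

end sample

section main

variable {n t : ℕ} (M : SimpleMatroid (Fin n)) (succ : Fin n → Fin n → Prop)
  {Fi : Fin n → Measure ℝ} [∀ i, IsProbabilityMeasure (Fi i)] {H : ℝ}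

/-- An auction whose expected revenue is within `6 ε` of that of a near-optimal `t`-level
auction is near-optimal. -/
lemma ofReal_mul_OPTM_le [IsStrictTotalOrder (Fin n) succ] (hH : 1 ≤ H)
    (hsupp : ∀ i, Fi i (Set.Icc 1 H) = 1) {ε : ℝ} (hε : 0 < ε)
    {B : Finset (Fin n)} (hB : M.Indep B) (hBmax : ∀ I, M.Indep I → I.card ≤ B.card)
    {A : TLevel n t} (hA : ∀ i j, A.thr i j ∈ Set.Icc 1 H)
    (hopt : OPTM n M (Set.Icc 1 H) (Measure.pi Fi) ≤
        ENNReal.ofReal (1 + ε) * ∫⁻ v, ENNReal.ofReal (RevM M A succ v) ∂(Measure.pi Fi) +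
          ENNReal.ofReal (ε * B.card))
    {x : ℝ} (hx : ∫ v, RevM M A succ v ∂(Measure.pi Fi) ≤ x + 6 * ε) :
    ENNReal.ofReal (1 - 8 * ε) * OPTM n M (Set.Icc 1 H) (Measure.pi Fi) ≤ ENNReal.ofReal x := by
  have h0 : ∀ v, 0 ≤ RevM M A succ v := fun v => by
    rw [RevM_eq_sum]
    exact Finset.sum_nonneg fun i _ =>
      critPrice_nonneg M A succ (fun i j => zero_le_one.trans (hA i j).1) _ i
  have hint : Integrable (RevM M A succ) (Measure.pi Fi) :=
    Integrable.of_mem_Icc 0 (n * H) (measurable_RevM M A succ).aemeasurable (by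
      filter_upwards [ae_mem_Icc_pi hsupp] with v hv
      exact ⟨h0 v, RevM_le M A succ (zero_le_one.trans hH) fun i => (hv i).2⟩)
  rw [← ofReal_integral_eq_lintegral_ofReal hint (.of_forall h0)] at hopt
  set R := ∫ v, RevM M A succ v ∂(Measure.pi Fi) with hR
  have hR0 : 0 ≤ R := integral_nonneg h0
  rw [← ENNReal.ofReal_mul (by linarith), ← ENNReal.ofReal_add (by positivity) (by positivity)]
    at hopt
  rcases Nat.eq_zero_or_pos B.card with hr | hr
  · have hzero : ∀ v, RevM M A succ v = 0 := by
      intro v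
      have h1 := hBmax _ (indep_greedySet M (succ := succ) (A.levels v))
      rw [hr, Nat.le_zero, Finset.card_eq_zero] at h1
      rw [RevM_eq_sum, h1, Finset.sum_empty]
    have hRz : R = 0 := by simp [hR, hzero]
    have : OPTM n M (Set.Icc 1 H) (Measure.pi Fi) = 0 := by
      simpa [hRz, hr] using hopt
    simp [this]
  · have hge := card_le_OPTM (Fi := Fi) (H := H) M hB
    have hfin : OPTM n M (Set.Icc 1 H) (Measure.pi Fi) ≠ ∞ :=
      ne_top_of_le_ne_top ENNReal.ofReal_ne_top hopt
    lift OPTM n M (Set.Icc 1 H) (Measure.pi Fi) to NNReal using hfin with O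
    have hO1 : (B.card : ℝ) ≤ O := by exact_mod_cast hge
    have hO2 : (O : ℝ) ≤ (1 + ε) * R + ε * B.card := by
      rw [← ENNReal.ofReal_coe_nnreal] at hopt
      exact (ENNReal.ofReal_le_ofReal_iff (by positivity)).1 hopt
    have hr1 : (1 : ℝ) ≤ B.card := by exact_mod_cast hr
    rw [← ENNReal.ofReal_coe_nnreal, ← ENNReal.ofReal_mul' O.coe_nonneg]
    apply ENNReal.ofReal_le_ofReal
    have h2 : (1 - ε) * (O : ℝ) ≤ (1 + ε) * R := by nlinarith
    have h3 : (1 - 2 * ε) * (O : ℝ) ≤ R := by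
      have : 0 ≤ ε ^ 2 * O := by positivity
      have h4 : (1 + ε) * ((1 - 2 * ε) * O) ≤ (1 + ε) * R := by nlinarith
      exact le_of_mul_le_mul_left h4 (by linarith)
    nlinarith

/-- With high probability every empirical revenue maximizer is near-optimal. -/
lemma ofReal_one_sub_le_measure_maximizers [IsStrictTotalOrder (Fin n) succ] (hn : 1 ≤ n)
    (hH : 1 ≤ H) {ε δ : ℝ} (hε : 0 < ε) (hε1 : ε ≤ 1) (hδ : 0 < δ) (hδ1 : δ ≤ 1)
    (hatom : ∀ i x, Fi i {x} = 0) (hsupp : ∀ i, Fi i (Set.Icc 1 H) = 1)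
    (ht : 2 * (1 / ε + Real.log H / Real.log (1 + ε)) ≤ t) {m : ℕ}
    (hm : 27 * (H * n / ε) ^ 2 * (n * t * Real.log (n * t + 2) * (1 + Real.log (H * n / ε)) +
      Real.log (1 / δ)) ≤ m) :
    ENNReal.ofReal (1 - δ) ≤
      (Measure.pi fun _ : Fin m => Measure.pi Fi)
        {S | ∀ Ahat : TLevel n t,
          (∀ A : TLevel n t, (∑ j, RevM M A succ (S j)) ≤ ∑ j, RevM M Ahat succ (S j)) →
          ENNReal.ofReal (1 - 8 * ε) * OPTM n M (Set.Icc 1 H) (Measure.pi Fi) ≤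
            ∫⁻ v, ENNReal.ofReal (RevM M Ahat succ v) ∂(Measure.pi Fi)} := by
  have hH0 : 0 ≤ H := by linarith
  have hlogH : 0 ≤ Real.log H / Real.log (1 + ε) :=
    div_nonneg (Real.log_nonneg hH) (Real.log_nonneg (by linarith))
  have ht1 : 1 ≤ t := by
    have h1 : 1 ≤ 1 / ε := by rwa [one_le_div hε]
    have h2 : (1 : ℝ) ≤ t := by linarith
    exact_mod_cast h2
  have hm1 : 0 < (m : ℝ) := by
    refine lt_of_lt_of_le ?_ hm
    have hn' : (1 : ℝ) ≤ n := by exact_mod_cast hn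
    have ht' : (1 : ℝ) ≤ t := by exact_mod_cast ht1
    have h1 : 1 ≤ H * n / ε := by
      rw [one_le_div hε]
      nlinarith
    have h2 := Real.log_nonneg h1
    have h3 : 0 < Real.log (n * t + 2) := Real.log_pos (by nlinarith)
    have h4 : 0 ≤ Real.log (1 / δ) := Real.log_nonneg (by rwa [one_le_div hδ])
    positivity
  obtain ⟨B, hB, hBmax⟩ := M.exists_max_indep
  obtain ⟨A, hA, hopt⟩ :=
    exists_tlevel_near_optimal_of_le M succ hH hatom hsupp hε hε1 ht hBmax
  obtain ⟨E₁, hE₁, hES⟩ :=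
    exists_forall_sum_safeRev_le M succ hn ht1 hH hatom hsupp hε hε1 m
  set R := ∫ v, RevM M A succ v ∂(Measure.pi Fi) with hR
  set E₂ : Set (Fin m → Fin n → ℝ) :=
    {S | ∑ j, RevM M A succ (S j) ≤ m * R - m * ε} with hE₂def
  have hE₂ : (Measure.pi fun _ : Fin m => Measure.pi Fi).real E₂ ≤
      Real.exp (-(2 * m * ε ^ 2 / (n * H) ^ 2)) := by
    have := measureReal_sum_le_le_exp (μ := Measure.pi Fi) (measurable_RevM M A succ)
      (a := 0) (b := n * H) (by
        filter_upwards [ae_mem_Icc_pi hsupp] with v hv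
        refine ⟨?_, RevM_le M A succ hH0 fun i => (hv i).2⟩
        rw [RevM_eq_sum]
        exact Finset.sum_nonneg fun i _ =>
          critPrice_nonneg M A succ (fun i j => zero_le_one.trans (hA i j).1) _ i) hε.le m
    rwa [sub_zero] at this
  set T := {S : Fin m → Fin n → ℝ | ∀ Ahat : TLevel n t,
    (∀ A : TLevel n t, (∑ j, RevM M A succ (S j)) ≤ ∑ j, RevM M Ahat succ (S j)) →
      ENNReal.ofReal (1 - 8 * ε) * OPTM n M (Set.Icc 1 H) (Measure.pi Fi) ≤
        ∫⁻ v, ENNReal.ofReal (RevM M Ahat succ v) ∂(Measure.pi Fi)} with hT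
  have hgood : ∀ S ∉ E₁ ∪ E₂, (∀ j i, S j i ∈ Set.Icc 1 H) → S ∈ T := by
    intro S hS hSV A' hmax
    have hS₁ := hES S (fun h => hS (Or.inl h)) hSV A'
    have hS₂ : m * R - m * ε < ∑ j, RevM M A succ (S j) :=
      not_le.1 fun h => hS (Or.inr h)
    have hsafe : ∑ j, safeRev M A' succ (S j) = ∑ j, RevM M A' succ (S j) :=
      Finset.sum_congr rfl fun j _ => safeRev_eq_RevM M A' succ
        (one_le_critPrice_of_isMax M A' succ (fun j i => (hSV j i).1) (hmax _) j)
    have h1 : m * R < m * (∫ v, safeRev M A' succ v ∂(Measure.pi Fi) + 6 * ε) := by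
      have := hmax A
      linarith
    refine (ofReal_mul_OPTM_le M succ hH hsupp hε hB hBmax hA hopt
      (lt_of_mul_lt_mul_left h1 hm1.le).le).trans ?_
    have hint : Integrable (safeRev M A' succ) (Measure.pi Fi) :=
      Integrable.of_mem_Icc 0 (n * H) (measurable_safeRev M A' succ).aemeasurable (by
        filter_upwards [ae_mem_Icc_pi hsupp] with v hv
        exact ⟨safeRev_nonneg M A' succ v, safeRev_le M A' succ hH0 fun i => (hv i).2⟩)
    rw [ofReal_integral_eq_lintegral_ofReal hint (.of_forall (safeRev_nonneg M A' succ))]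
    exact lintegral_mono fun v => ofReal_safeRev_le M A' succ v
  have hae : ∀ᵐ S ∂(Measure.pi fun _ : Fin m => Measure.pi Fi), ∀ j i, S j i ∈ Set.Icc 1 H := by
    refine ae_all_iff.2 fun j => ?_
    exact (measurePreserving_eval (fun _ : Fin m => Measure.pi Fi) j).quasiMeasurePreserving.ae
      (ae_mem_Icc_pi hsupp)
  have hbad : (Measure.pi fun _ : Fin m => Measure.pi Fi) (E₁ ∪ E₂) ≤ ENNReal.ofReal δ := by
    rw [← ENNReal.ofReal_toReal (measure_ne_top _ (E₁ ∪ E₂))]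
    apply ENNReal.ofReal_le_ofReal
    exact (measureReal_union_le _ _).trans ((add_le_add hE₁ hE₂).trans
      (pow_mul_exp_add_exp_le hn ht1 hH hε hε1 hδ hδ1 hm))
  have hone : 1 ≤ (Measure.pi fun _ : Fin m => Measure.pi Fi) T + ENNReal.ofReal δ := by
    refine le_trans ?_ (add_le_add le_rfl hbad)
    refine le_trans ?_ (measure_union_le _ _)
    rw [← measure_univ (μ := Measure.pi fun _ : Fin m => Measure.pi Fi)]
    refine measure_mono_ae ?_
    filter_upwards [hae] with S hS _
    by_cases h : S ∈ E₁ ∪ E₂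
    · exact Or.inr h
    · exact Or.inl (hgood S h hS)
  rw [ENNReal.ofReal_sub _ hδ.le, ENNReal.ofReal_one]
  exact tsub_le_iff_right.2 hone

end main

/-- Sample complexity of learning a near-optimal `t`-level matroid auction: there are
universal constants `c₁, c₂, c₃ > 0` such that, for a matroid environment with product
valuations with atomless marginals supported in `[1,H]`, with
`t = ⌈c₁(1/ε + ln H / ln(1+ε))⌉` and
`m ≥ c₂ (Hn/ε)² (n t ln(nt+2)(1 + ln(Hn/ε)) + ln(1/δ))` i.i.d. samples, with
probability at least `1 - δ` every empirical-revenue-maximizing `t`-level matroid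
auction obtains expected revenue at least `(1 - c₃ ε)` times optimal. -/
theorem sample_complexity_tlevel_matroid :
    ∃ c₁ c₂ c₃ : ℝ, 0 < c₁ ∧ 0 < c₂ ∧ 0 < c₃ ∧
      ∀ n : ℕ, 1 ≤ n →
      ∀ M : SimpleMatroid (Fin n),
      ∀ H : ℝ, 1 ≤ H →
      ∀ ε δ : ℝ, ε ∈ Set.Ioo (0 : ℝ) 1 → δ ∈ Set.Ioo (0 : ℝ) 1 →
      ∀ succ : Fin n → Fin n → Prop, IsStrictTotalOrder (Fin n) succ →
      ∀ Fi : Fin n → Measure ℝ,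
        (∀ i, IsProbabilityMeasure (Fi i)) →
        (∀ i, ∀ x : ℝ, Fi i {x} = 0) →
        (∀ i, Fi i (Set.Icc 1 H) = 1) →
      ∀ t : ℕ, t = ⌈c₁ * (1 / ε + Real.log H / Real.log (1 + ε))⌉₊ →
      ∀ m : ℕ,
        c₂ * (H * n / ε) ^ 2 *
            (n * t * Real.log (n * t + 2) * (1 + Real.log (H * n / ε)) +
              Real.log (1 / δ))
          ≤ m →
        ENNReal.ofReal (1 - δ) ≤
          (Measure.pi fun _ : Fin m => Measure.pi Fi)
            {S | ∀ Ahat : TLevel n t,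
              (∀ A : TLevel n t,
                (∑ j, RevM M A succ (S j)) ≤ ∑ j, RevM M Ahat succ (S j)) →
              ENNReal.ofReal (1 - c₃ * ε) * OPTM n M (Set.Icc 1 H) (Measure.pi Fi) ≤
                ∫⁻ v, ENNReal.ofReal (RevM M Ahat succ v) ∂(Measure.pi Fi)} := by
  refine ⟨2, 27, 8, by norm_num, by norm_num, by norm_num, ?_⟩
  intro n hn M H hH ε δ hε hδ succ hsucc Fi hFi hatom hsupp t ht m hm
  exact ofReal_one_sub_le_measure_maximizers M succ hn hH hε.1 hε.2.le hδ.1 hδ.2.le hatom hsupp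
    (ht ▸ Nat.le_ceil _) hm
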